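/- Let μ = (μ_1 ≥ μ_2 ≥ … ≥ μ_n ≥ 0) be a partition with at most ⌊n/2⌋ nonzero parts, set d := #{k : μ_k > 0}, and let μ̃ be the partition with μ̃_k = μ_k for k ≤ d, μ̃_k = 1 for d < k ≤ n−d, and μ̃_k = 0 for k > n−d. For a partition ν = (ν_1 ≥ … ≥ ν_n ≥ 0) with ν_{n+1} := 0, set v_{ν,S} := B_1^{ν_1−ν_2} B_2^{ν_2−ν_3} ⋯ B_{n−1}^{ν_{n−1}−ν_n} B_n^{ν_n} |0⟩ ∈ F_N(S). Then for ν = μ and for ν = μ̃, the vector v_{ν,S} is nonzero and satisfies: (a) ( Σ_{r∈S} q^{−br} Σ_{k=1}^{n} :psi_i^k(a−r) psibar_j^k(r): ) v_{ν,S} = 0 for all 1 ≤ i, j ≤ m and a, b ∈ ℤ with a > 0, or a = 0 and i < j; (b) ( Σ_{r∈S} q^{−br} Σ_{k=1}^{n} :psi_i^k(a−r) psi_j^{n+1−k}(r): ) v_{ν,S} = 0 for all 1 ≤ i, j ≤ m and a, b ∈ ℤ with a > 0, or a = 0 and S = ℤ + 1/2; (c) ( Σ_{r∈S} q^{−br}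 Σ_{k=1}^{n} :psibar_i^k(a−r) psibar_j^{n+1−k}(r): ) v_{ν,S} = 0 for all 1 ≤ i, j ≤ m and a, b ∈ ℤ with a > 0, or a = 0 and S = ℤ; (d) F_i(b) v_{ν,S} = η_{ν,S}(i,b) v_{ν,S} for all 1 ≤ i ≤ m and b ∈ ℤ, where F_i(b) := Σ_{r∈S} q^{−br} Σ_{k=1}^{n} :psi_i^k(−r) psibar_i^k(r): − nω_S(b)·Id; (e) ( Σ_{r∈S} Σ_{k=1}^{m} ( :psi_k^p(−r) psibar_k^{p+1}(r): − :psi_k^{n−p}(−r) psibar_k^{n+1−p}(r): ) ) v_{ν,S} = 0 for all 1 ≤ p ≤ n−1; (f) ( Σ_{r∈S} Σ_{k=1}^{m} ( :psi_k^p(−r) psibar_k^p(r): − :psi_k^{n+1−p}(−r) psibar_k^{n+1−p}(r): ) ) v_{ν,S} = μ_p v_{ν,S} for all 1 ≤ p ≤ ⌊n/2⌋. That is, v_{μ,S} and v_{μ̃,S} are joint (SO_n, sphat_{2m}(C_q))-highest weight vectors in F_N(S) with highest weights (μ, η_{μ,S}) and (μ, η_{μ̃,S}) respectively. -/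

import Mathlib

noncomputable section

/-- Context for the enlarged Weyl algebra `W_N(S)` with `N = m·n` and
`S = ℤ` (encoded by `sig = 0`) or `S = ℤ + 1/2` (encoded by `sig = 1`).
An element `r ∈ S` is encoded by the unique integer `k` with `r = k + sig/2`,
so that `ε := 1/2 - sig/2` and e.g. `r > 0 ↔ 0 < 2k + sig`.
The data also fixes a generic `q ∈ ℂˣ` together with a square root `sq` of `q`. -/
structure WCtx where
  m : ℕ
  n : ℕ
  hm : 0 < m
  hn : 0 < n
  sig : ℤ
  hsig : sig = 0 ∨ sig = 1
  q : ℂ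
  sq : ℂ
  hsq : sq ^ 2 = q
  hq0 : q ≠ 0
  hqu : ∀ k : ℕ, k ≠ 0 → q ^ k ≠ 1

namespace WCtx

variable (C : WCtx)

/-- `N = m n`. -/
def NN : ℕ := C.m * C.n

/-- Names of the generators of `W_N(S)`: `Sum.inl i` is `ψ_{i+1}` and
`Sum.inr i` is `ψ̄_{i+1}`; the integer `k` encodes the index `r = k + sig/2 ∈ S`. -/
abbrev Gen : Type := (Fin C.NN ⊕ Fin C.NN) × ℤ

/-- The defining relations of the enlarged Weyl algebra `W_N(S)`:
any two `ψ`'s commute, any two `ψ̄`'s commute, and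
`ψ̄_i(k)ψ_j(r) − ψ_j(r)ψ̄_i(k) = δ_{i,j} δ_{k+r,0}`. -/
inductive rel : FreeAlgebra ℂ C.Gen → FreeAlgebra ℂ C.Gen → Prop
  | comm_psi (i j : Fin C.NN) (k l : ℤ) :
      rel (FreeAlgebra.ι ℂ ((Sum.inl i, k) : C.Gen) * FreeAlgebra.ι ℂ ((Sum.inl j, l) : C.Gen))
          (FreeAlgebra.ι ℂ ((Sum.inl j, l) : C.Gen) * FreeAlgebra.ι ℂ ((Sum.inl i, k) : C.Gen))
  | comm_psibar (i j : Fin C.NN) (k l : ℤ) :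
      rel (FreeAlgebra.ι ℂ ((Sum.inr i, k) : C.Gen) * FreeAlgebra.ι ℂ ((Sum.inr j, l) : C.Gen))
          (FreeAlgebra.ι ℂ ((Sum.inr j, l) : C.Gen) * FreeAlgebra.ι ℂ ((Sum.inr i, k) : C.Gen))
  | mixed (i j : Fin C.NN) (k l : ℤ) :
      rel (FreeAlgebra.ι ℂ ((Sum.inr i, k) : C.Gen) * FreeAlgebra.ι ℂ ((Sum.inl j, l) : C.Gen))
          (FreeAlgebra.ι ℂ ((Sum.inl j, l) : C.Gen) * FreeAlgebra.ι ℂ ((Sum.inr i, k) : C.Gen)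
            + (if i = j ∧ k + l + C.sig = 0 then 1 else 0))

/-- The enlarged Weyl algebra `W_N(S)`. -/
def W : Type := RingQuot C.rel

instance : Ring C.W := inferInstanceAs (Ring (RingQuot C.rel))
instance : Algebra ℂ C.W := inferInstanceAs (Algebra ℂ (RingQuot C.rel))

/-- `ψ` with `0`-indexed flat subscript. -/
def psi0 (i : Fin C.NN) (k : ℤ) : C.W :=
  RingQuot.mkAlgHom ℂ C.rel (FreeAlgebra.ι ℂ ((Sum.inl i, k) : C.Gen))

/-- `ψ̄` with `0`-indexed flat subscript. -/
def psibar0 (i : Fin C.NN) (k : ℤ) : C.W :=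
  RingQuot.mkAlgHom ℂ C.rel (FreeAlgebra.ι ℂ ((Sum.inr i, k) : C.Gen))

/-- `ψ_i(r)` with `1`-indexed flat subscript `i ∈ {1,…,N}` (junk value `0` outside). -/
def psiF (i : ℕ) (k : ℤ) : C.W :=
  if h : 1 ≤ i ∧ i ≤ C.NN then C.psi0 ⟨i - 1, by omega⟩ k else 0

/-- `ψ̄_i(r)` with `1`-indexed flat subscript `i ∈ {1,…,N}` (junk value `0` outside). -/
def psibarF (i : ℕ) (k : ℤ) : C.W :=
  if h : 1 ≤ i ∧ i ≤ C.NN then C.psibar0 ⟨i - 1, by omega⟩ k else 0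

/-- `ψ_i^c(r) = ψ_{i+(c-1)m}(r)`, subscript `i ∈ {1,…,m}`, superscript `c ∈ {1,…,n}`. -/
def psiS (i c : ℕ) (k : ℤ) : C.W := C.psiF (i + (c - 1) * C.m) k

/-- `ψ̄_i^c(r) = ψ̄_{i+(c-1)m}(r)`. -/
def psibarS (i c : ℕ) (k : ℤ) : C.W := C.psibarF (i + (c - 1) * C.m) k

/-- The left ideal of `W_N(S)` generated by all `ψ_i(r), ψ̄_i(r)` with `r > 0`,
together with all `ψ̄_i(0)` when `S = ℤ`. -/
def vacIdeal : Submodule C.W C.W :=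
  Submodule.span C.W
    {w : C.W |
      (∃ (i : Fin C.NN) (k : ℤ), 0 < 2 * k + C.sig ∧ (w = C.psi0 i k ∨ w = C.psibar0 i k)) ∨
        (C.sig = 0 ∧ ∃ i : Fin C.NN, w = C.psibar0 i 0)}

/-- The Fock module `F_N(S) = W_N(S)/I`. -/
def F : Type := C.W ⧸ C.vacIdeal

instance : AddCommGroup C.F := inferInstanceAs (AddCommGroup (C.W ⧸ C.vacIdeal))
instance : Module C.W C.F := inferInstanceAs (Module C.W (C.W ⧸ C.vacIdeal))
instance : Module ℂ C.F := inferInstanceAs (Module ℂ (C.W ⧸ C.vacIdeal))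

/-- The vacuum vector `|0⟩ ∈ F_N(S)`. -/
def vac : C.F := Submodule.Quotient.mk (1 : C.W)

/-- Normal ordering `:u(k) v(l):` where `l` encodes the `S`-index of the second factor. -/
def nord (u : C.W) (l : ℤ) (v : C.W) : C.W :=
  if 0 < 2 * l + C.sig then u * v
  else if 2 * l + C.sig = 0 then (2 : ℂ)⁻¹ • (u * v + v * u)
  else v * u

/-- `ε = 0` if `S = ℤ + 1/2`, `ε = 1/2` if `S = ℤ`, as a complex number. -/
def eps : ℂ := (1 - (C.sig : ℂ)) / 2

/-- `ω_S(b)`. -/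
def om (b : ℤ) : ℂ :=
  if b = 0 then 0
  else if C.sig = 0 then (2 : ℂ)⁻¹ * ((C.q ^ b + 1) / (C.q ^ b - 1))
  else C.sq ^ b / (C.q ^ b - 1)

/-- `q^{-b r}` for `r = k + sig/2 ∈ S`. -/
def qp (b k : ℤ) : ℂ := C.sq ^ (-(b * (2 * k + C.sig)))

/-- `q^{b r}` for `r = k + sig/2 ∈ S`. -/
def qpp (b k : ℤ) : ℂ := C.sq ^ (b * (2 * k + C.sig))

/-- `φ^c_{t + sig/2}`; here `t ∈ ℤ` encodes the half-integer index `t + sig/2 = t + 1/2 - ε`.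
Writing `t = (k + sig)m - i` with `1 ≤ i ≤ m`, `k ∈ ℤ`, this is `ψ_i^c(k + sig/2)`. -/
def PhiW (c : ℕ) (t : ℤ) : C.W :=
  C.psiF ((((-t - 1).emod C.m).toNat + 1) + (c - 1) * C.m)
    ((t + (-t - 1).emod C.m + 1) / C.m - C.sig)

/-- `φ̄^c_{t + sig/2}`; writing `t = k·m + i - 1` with `1 ≤ i ≤ m`, `k ∈ ℤ`,
this is `ψ̄_i^c(k + sig/2)`. -/
def PhibarW (c : ℕ) (t : ℤ) : C.W :=
  C.psibarF (((t.emod C.m).toNat + 1) + (c - 1) * C.m) ((t - t.emod C.m) / C.m)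

/-- Determinant of a square matrix with (pairwise commuting) entries in `W_N(S)`. -/
def ncdet {l : ℕ} (M : Fin l → Fin l → C.W) : C.W :=
  ∑ p : Equiv.Perm (Fin l),
    (((Equiv.Perm.sign p : ℤˣ) : ℤ)) • ((List.finRange l).map fun t => M (p t) t).prod

/-- The element `A_l ∈ W_N(S)`, `1 ≤ l ≤ n`. -/
def Adet (l : ℕ) : C.W :=
  C.ncdet fun k t : Fin l => C.PhiW ((k : ℕ) + 1) (-(((t : ℕ) : ℤ) + 1))

/-- The element `Ā_l ∈ W_N(S)`, `1 ≤ l ≤ n`. -/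
def Abar (l : ℕ) : C.W :=
  C.ncdet fun s t : Fin (C.n - l + 1) => C.PhibarW (C.n - (s : ℕ)) (-(((t : ℕ) : ℤ) + 1))

/-- `α(r,a,i) = (a - r + 1/2 - ε)m - i + 1 = (a-k)m - i + 1` for `r = k + sig/2`. -/
def alphaV (k a : ℤ) (i : ℕ) : ℤ := (a - k) * C.m - (i : ℤ) + 1

/-- `β(r,a,j) = (r + a - 1/2 + ε)m + j = (k+a)m + j` for `r = k + sig/2`. -/
def betaV (k a : ℤ) (j : ℕ) : ℤ := (k + a) * C.m + (j : ℤ)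

/-- `Σ_{c=1}^{n} ψ_i^c(a-r) ψ̄_j^c(r)`, where `k` encodes `r`. -/
def Esum (i j : ℕ) (a k : ℤ) : C.W :=
  ∑ c : Fin C.n, C.psiS i ((c : ℕ) + 1) (a - k - C.sig) * C.psibarS j ((c : ℕ) + 1) k

/-- `A_l^{i,j,r}`: `A_l` with the `β(r,0,j)`-th column replaced by
`(φ^1_{α(r,a,i)-1/2-ε}, …, φ^l_{α(r,a,i)-1/2-ε})ᵗ`. -/
def Amod (l : ℕ) (i j : ℕ) (a k : ℤ) : C.W :=
  C.ncdet fun r t : Fin l =>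
    if (((t : ℕ) : ℤ) + 1) = C.betaV k 0 j then C.PhiW ((r : ℕ) + 1) (C.alphaV k a i - 1)
    else C.PhiW ((r : ℕ) + 1) (-(((t : ℕ) : ℤ) + 1))

/-- `Ā_l^{i,j,r}`: `Ā_l` with the `α(r,a,i)`-th column replaced by
`(-φ̄^n_{β(r,0,j)-1/2-ε}, …, -φ̄^l_{β(r,0,j)-1/2-ε})ᵗ`. -/
def Abarmod (l : ℕ) (i j : ℕ) (a k : ℤ) : C.W :=
  C.ncdet fun s t : Fin (C.n - l + 1) =>
    if (((t : ℕ) : ℤ) + 1) = C.alphaV k a i then -C.PhibarW (C.n - (s : ℕ)) (C.betaV k 0 j - 1)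
    else C.PhibarW (C.n - (s : ℕ)) (-(((t : ℕ) : ℤ) + 1))

/-- `l̄₁` for `l = l₁ m + l₂`, `1 ≤ l₂ ≤ m`. -/
def lb1 (l : ℕ) : ℕ :=
  if (l - 1) / C.m % 2 = 0 then ((l - 1) / C.m / 2) * C.m + ((l - 1) % C.m + 1)
  else (((l - 1) / C.m + 1) / 2) * C.m

/-- `l̄₂ = l - l̄₁`. -/
def lb2 (l : ℕ) : ℕ := l - C.lb1 l

/-- The `(k,t)` entry of the matrix defining `B_l`. -/
def Bentry (l : ℕ) (k t : Fin l) : C.W :=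
  if (t : ℕ) + 1 ≤ C.lb1 l then C.PhiW ((k : ℕ) + 1) (-(((t : ℕ) : ℤ) + 1))
  else C.PhibarW (C.n - (k : ℕ)) (-((((t : ℕ) : ℤ) + 1) - (C.lb1 l : ℤ)))

/-- The element `B_l ∈ W_N(S)`, `1 ≤ l ≤ n`. -/
def Bdet (l : ℕ) : C.W := C.ncdet (C.Bentry l)

/-- The element `B̄_{n/2} ∈ W_N(S)` (`n` even): `B_{n/2}` with its `(n/2)`-th row replaced. -/
def Bbar : C.W :=
  C.ncdet fun k t : Fin (C.n / 2) =>
    if (k : ℕ) + 1 = C.n / 2 then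
      (if (t : ℕ) + 1 ≤ C.lb1 (C.n / 2) then C.PhiW (C.n / 2 + 1) (-(((t : ℕ) : ℤ) + 1))
       else C.PhibarW (C.n / 2) (-((((t : ℕ) : ℤ) + 1) - (C.lb1 (C.n / 2) : ℤ))))
    else C.Bentry (C.n / 2) k t

/-- `B_l` with its `pos`-th column replaced by the column `(col 1, …, col l)ᵗ`. -/
def Bcolrep (l : ℕ) (pos : ℤ) (col : ℕ → C.W) : C.W :=
  C.ncdet fun k t : Fin l =>
    if (((t : ℕ) : ℤ) + 1) = pos then col ((k : ℕ) + 1) else C.Bentry l k t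

/-- The operator `T_{i,j}(a,b) = Σ_{r∈S} q^{-br} Σ_{c=1}^n :ψ_i^c(a-r) ψ̄_j^c(r):`. -/
def Top (i j : ℕ) (a b : ℤ) (x : C.F) : C.F :=
  ∑ᶠ k : ℤ, (C.qp b k • ∑ c : Fin C.n,
    C.nord (C.psiS i ((c : ℕ) + 1) (a - k - C.sig)) k (C.psibarS j ((c : ℕ) + 1) k)) • x

/-- The operator `S_{i,j}(c,d) = Σ_{e=1}^n ψ_i^e(c) ψ̄_j^e(d)`. -/
def Sop (i j : ℕ) (c d : ℤ) (x : C.F) : C.F :=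
  (∑ e : Fin C.n, C.psiS i ((e : ℕ) + 1) c * C.psibarS j ((e : ℕ) + 1) d) • x

/-- The operator `E_{p,p} = Σ_{c=1}^m Σ_{r∈S} :ψ_c^p(-r) ψ̄_c^p(r): − ε m`. -/
def Epp (p : ℕ) (x : C.F) : C.F :=
  (∑ᶠ k : ℤ, (∑ c : Fin C.m,
      C.nord (C.psiS ((c : ℕ) + 1) p (-k - C.sig)) k (C.psibarS ((c : ℕ) + 1) p k)) • x)
    - (C.eps * (C.m : ℂ)) • x

/-- The operator `E_i(b) = Σ_{r∈S} q^{-br} Σ_{c=1}^n :ψ_i^c(-r) ψ̄_i^c(r): − n ω_S(b)`. -/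
def Eib (i : ℕ) (b : ℤ) (x : C.F) : C.F :=
  (∑ᶠ k : ℤ, (C.qp b k • ∑ c : Fin C.n,
      C.nord (C.psiS i ((c : ℕ) + 1) (-k - C.sig)) k (C.psibarS i ((c : ℕ) + 1) k)) • x)
    - ((C.n : ℂ) * C.om b) • x

/-- `Σ_{r ∈ J^S_{i,l}} q^{-br}`. -/
def Jsum (i l : ℕ) (b : ℤ) : ℂ :=
  ∑ᶠ k ∈ {k : ℤ | 1 ≤ k * (C.m : ℤ) + (i : ℤ) ∧ k * (C.m : ℤ) + (i : ℤ) ≤ (l : ℤ)}, C.qp b k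

/-- `Σ_{r ∈ J̄^S_{i,l}} q^{-br}`. -/
def Jbarsum (i l : ℕ) (b : ℤ) : ℂ :=
  ∑ᶠ k ∈ {k : ℤ | 1 ≤ -(k * (C.m : ℤ)) - (i : ℤ) + 1 ∧ -(k * (C.m : ℤ)) - (i : ℤ) + 1 ≤ (l : ℤ)},
    C.qp b k

/-- `Σ_{r ∈ J^S_{i,l}} q^{br}`. -/
def JsumP (i l : ℕ) (b : ℤ) : ℂ :=
  ∑ᶠ k ∈ {k : ℤ | 1 ≤ k * (C.m : ℤ) + (i : ℤ) ∧ k * (C.m : ℤ) + (i : ℤ) ≤ (l : ℤ)}, C.qpp b k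

/-- `Σ_{c=1}^m ψ_c^p(-r) ψ̄_c^{p+1}(r)` (no normal ordering), `k` encoding `r ∈ S`. -/
def glRaise (p : ℕ) (k : ℤ) : C.W :=
  ∑ c : Fin C.m, C.psiS ((c : ℕ) + 1) p (-k - C.sig) * C.psibarS ((c : ℕ) + 1) (p + 1) k

/-- The operator `Σ_{c=1}^m Σ_{r∈S} :ψ_c^p(-r) ψ̄_c^{p+1}(r):`. -/
def glRaiseOp (p : ℕ) (x : C.F) : C.F :=
  ∑ᶠ k : ℤ, (∑ c : Fin C.m,
    C.nord (C.psiS ((c : ℕ) + 1) p (-k - C.sig)) k (C.psibarS ((c : ℕ) + 1) (p + 1) k)) • x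

end WCtx

namespace WCtx

variable (C : WCtx)

/-- The vector `v_{ν,S} = B_1^{ν_1-ν_2} B_2^{ν_2-ν_3} ⋯ B_n^{ν_n} |0⟩`. -/
def vB (ν : ℕ → ℤ) : C.F :=
  (((List.range C.n).map fun idx =>
      C.Bdet (idx + 1) ^ ((ν (idx + 1) - ν (idx + 2)).toNat)).prod) • C.vac

/-- The highest weight `η_{ν,S}(i,b)` for the pair `(O_n, ŝp_{2m}(C_q))`. -/
def etaB (ν : ℕ → ℤ) (i : ℕ) (b : ℤ) : ℂ :=
  (∑ k ∈ Finset.Icc 1 C.n,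
      ((ν k - ν (k + 1) : ℤ) : ℂ) * (C.Jsum i (C.lb1 k) b - C.Jbarsum i (C.lb2 k) b))
    + C.eps * (C.n : ℂ) - (C.n : ℂ) * C.om b

end WCtx

section DeterminantDerivations

open MvPolynomial

theorem derivation_finset_prod {ι P : Type*} [DecidableEq ι] [CommRing P] [Algebra ℂ P]
    (D : Derivation ℂ P P) (s : Finset ι) (f : ι → P) :
    D (∏ i ∈ s, f i) = ∑ i ∈ s, (∏ j ∈ s.erase i, f j) * D (f i) := by
  induction s using Finset.induction_on with
  | empty => simp
  | insert a s ha ih =>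
    rw [Finset.prod_insert ha, D.leibniz, ih, Finset.sum_insert ha, Finset.erase_insert ha,
      smul_eq_mul, smul_eq_mul, add_comm, Finset.mul_sum]
    congr 1
    refine Finset.sum_congr rfl fun i hi => ?_
    have hia : a ≠ i := fun h => ha (h ▸ hi)
    rw [Finset.erase_insert_of_ne hia, Finset.prod_insert (fun h => ha (Finset.mem_of_mem_erase h)),
      mul_assoc]

/-- Leibniz rule for a determinant, column by column. -/
theorem derivation_det {ι P : Type*} [Fintype ι] [DecidableEq ι] [CommRing P] [Algebra ℂ P]
    (D : Derivation ℂ P P) (M : Matrix ι ι P) :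
    D M.det = ∑ t, (M.updateCol t fun k => D (M k t)).det := by
  simp only [Matrix.det_apply, map_sum]
  rw [Finset.sum_comm]
  refine Finset.sum_congr rfl fun σ _ => ?_
  rw [Units.smul_def, map_zsmul, derivation_finset_prod, Finset.smul_sum]
  refine Finset.sum_congr rfl fun t _ => ?_
  rw [Units.smul_def, ← Finset.mul_prod_erase Finset.univ _ (Finset.mem_univ t), mul_comm]
  congr 2
  · simp
  · refine Finset.prod_congr rfl fun i hi => ?_
    rw [Matrix.updateCol_ne (Finset.ne_of_mem_erase hi)]

/-- Leibniz rule for a determinant, row by row. -/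
theorem derivation_det_row {ι P : Type*} [Fintype ι] [DecidableEq ι] [CommRing P] [Algebra ℂ P]
    (D : Derivation ℂ P P) (M : Matrix ι ι P) :
    D M.det = ∑ k, (M.updateRow k fun t => D (M k t)).det := by
  rw [← Matrix.det_transpose, derivation_det]
  refine Finset.sum_congr rfl fun k _ => ?_
  rw [← Matrix.det_transpose, ← Matrix.updateRow_transpose, Matrix.transpose_transpose]
  rfl

/-- A product of powers of eigenvectors of a derivation is an eigenvector. -/
theorem derivation_prod_pow_eigen {P : Type*} [CommRing P] [Algebra ℂ P] {ι : Type*}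
    [DecidableEq ι] (D : Derivation ℂ P P) (s : Finset ι) (f : ι → P) (e : ι → ℕ) (c : ι → ℂ)
    (h : ∀ i ∈ s, e i ≠ 0 → D (f i) = c i • f i) :
    D (∏ i ∈ s, f i ^ e i) = (∑ i ∈ s, (e i : ℂ) * c i) • ∏ i ∈ s, f i ^ e i := by
  induction s using Finset.induction_on with
  | empty => simp
  | insert a s ha ih =>
    have hpow : D (f a ^ e a) = ((e a : ℂ) * c a) • f a ^ e a := by
      rcases Nat.eq_zero_or_pos (e a) with h0 | h0
      · simp [h0]
      · rw [D.leibniz_pow, h a (Finset.mem_insert_self a s) h0.ne', smul_eq_mul, mul_smul_comm,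
          ← pow_succ, Nat.sub_add_cancel h0, mul_smul, Nat.cast_smul_eq_nsmul]
    rw [Finset.prod_insert ha, D.leibniz, ih fun i hi => h i (Finset.mem_insert_of_mem hi), hpow,
      Finset.sum_insert ha, add_smul, smul_eq_mul, smul_eq_mul, mul_smul_comm, mul_smul_comm,
      add_comm, mul_comm (∏ i ∈ s, _)]

variable {n : ℕ}

theorem derivation_sum_apply {ι P : Type*} [CommRing P] [Algebra ℂ P] (s : Finset ι)
    (D : ι → Derivation ℂ P P) (f : P) : (∑ i ∈ s, D i) f = ∑ i ∈ s, D i f := by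
  rw [← Derivation.coeFnAddMonoidHom_apply, map_sum, Finset.sum_apply]
  rfl

theorem pderiv_pderiv_comm {σ : Type*} (i j : σ) (f : MvPolynomial σ ℂ) :
    pderiv i (pderiv j f) = pderiv j (pderiv i f) := by
  classical
  have h : ⁅(pderiv i : Derivation ℂ (MvPolynomial σ ℂ) (MvPolynomial σ ℂ)),
      (pderiv j : Derivation ℂ (MvPolynomial σ ℂ) (MvPolynomial σ ℂ))⁆ = 0 := by
    refine derivation_ext fun k => ?_
    rw [Derivation.commutator_apply]
    simp only [pderiv_X, Pi.single_apply]
    split_ifs <;> simp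
  have := congrArg (fun D : Derivation ℂ (MvPolynomial σ ℂ) (MvPolynomial σ ℂ) => D f) h
  rw [Derivation.commutator_apply] at this
  exact sub_eq_zero.1 this

open scoped IsMulCommutative in
/-- Evaluation of polynomials at pairwise commuting elements of a noncommutative algebra. -/
theorem exists_algHom_of_commute {σ A : Type*} [Ring A] [Algebra ℂ A] (x : σ → A)
    (h : ∀ v w, x v * x w = x w * x v) :
    ∃ f : MvPolynomial σ ℂ →ₐ[ℂ] A, ∀ v, f (X v) = x v := by
  have hcomm : ∀ a ∈ Set.range x, ∀ b ∈ Set.range x, a * b = b * a := by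
    rintro _ ⟨v, rfl⟩ _ ⟨w, rfl⟩
    exact h v w
  have := Algebra.isMulCommutative_adjoin ℂ hcomm
  let y (v : σ) : Algebra.adjoin ℂ (Set.range x) := ⟨x v, Algebra.subset_adjoin ⟨v, rfl⟩⟩
  exact ⟨(Algebra.adjoin ℂ (Set.range x)).val.comp (aeval y), fun v => by simp [y]⟩

/-- Variables of the Fock space: a kind and position, and a row. -/
abbrev FVar (n : ℕ) : Type := (Bool × ℕ) × Fin n

abbrev FPoly (n : ℕ) : Type := MvPolynomial (FVar n) ℂ

/-- Matrix of variables with prescribed columns and rows `0, …, l - 1`. -/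
def colMat {l : ℕ} (hl : l ≤ n) (col : Fin l → Bool × ℕ) : Matrix (Fin l) (Fin l) (FPoly n) :=
  Matrix.of fun k t => X (col t, Fin.castLE hl k)

theorem colMat_det_ne_zero {l : ℕ} (hl : l ≤ n) {col : Fin l → Bool × ℕ}
    (hc : Function.Injective col) : (colMat hl col).det ≠ 0 := by
  have h : colMat hl col = (Matrix.mvPolynomialX (Fin l) (Fin l) ℂ).map
      (rename fun kt : Fin l × Fin l => (col kt.2, Fin.castLE hl kt.1)) := by
    ext k t : 2
    simp [colMat]
  rw [h, ← AlgHom.mapMatrix_apply, ← AlgHom.map_det]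
  intro h0
  refine Matrix.det_mvPolynomialX_ne_zero (Fin l) ℂ ((map_eq_zero_iff _ ?_).1 h0)
  refine rename_injective _ fun x y hxy => ?_
  simp only [Prod.mk.injEq, Fin.castLE_inj] at hxy
  exact Prod.ext hxy.2 (hc hxy.1)

/-- The derivation replacing the column `y` by the column `z`. -/
def colRepl (y z : Bool × ℕ) : Derivation ℂ (FPoly n) (FPoly n) :=
  ∑ c : Fin n, (X (z, c) : FPoly n) • pderiv (y, c)

theorem colRepl_apply (y z : Bool × ℕ) (p : FPoly n) :
    colRepl y z p = ∑ c : Fin n, X (z, c) * pderiv (y, c) p := by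
  simp [colRepl, derivation_sum_apply]

theorem colRepl_X (y z x : Bool × ℕ) (c : Fin n) :
    colRepl y z (X (x, c)) = if x = y then X (z, c) else 0 := by
  rw [colRepl_apply, Finset.sum_eq_single c]
  · rw [pderiv_X]
    by_cases h : x = y <;> simp [h]
  · intro b _ hb
    rw [pderiv_X_of_ne (by simp [hb.symm]), mul_zero]
  · simp

theorem colRepl_det_eq_zero {l : ℕ} (hl : l ≤ n) (col : Fin l → Bool × ℕ) {y z : Bool × ℕ}
    (hyz : y ≠ z) (h : y ∈ Set.range col → z ∈ Set.range col) :
    colRepl y z (colMat hl col).det = 0 := by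
  rw [derivation_det]
  refine Finset.sum_eq_zero fun t _ => ?_
  by_cases ht : col t = y
  · obtain ⟨t', ht'⟩ := h ⟨t, ht⟩
    have hne : t ≠ t' := by rintro rfl; exact hyz (ht.symm.trans ht')
    refine Matrix.det_zero_of_column_eq hne fun k => ?_
    rw [Matrix.updateCol_self, Matrix.updateCol_ne hne.symm]
    simp [colMat, colRepl_X, ht, ht']
  · exact Matrix.det_eq_zero_of_column_eq_zero t fun k => by simp [colMat, colRepl_X, ht]

theorem colRepl_self_det {l : ℕ} (hl : l ≤ n) {col : Fin l → Bool × ℕ}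
    (hc : Function.Injective col) (y : Bool × ℕ) [Decidable (y ∈ Set.range col)] :
    colRepl y y (colMat hl col).det
      = (if y ∈ Set.range col then (1 : ℂ) else 0) • (colMat hl col).det := by
  rw [derivation_det]
  split_ifs with h
  · obtain ⟨t, rfl⟩ := h
    rw [Finset.sum_eq_single t, one_smul]
    · congr 1
      convert Matrix.updateCol_eq_self _ t using 2
      ext1 k
      simp [colMat, colRepl_X]
    · intro s _ hs
      exact Matrix.det_eq_zero_of_column_eq_zero s fun k => by
        simp [colMat, colRepl_X, hc.ne hs]
    · simp
  · rw [zero_smul]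
    refine Finset.sum_eq_zero fun s _ => Matrix.det_eq_zero_of_column_eq_zero s fun k => ?_
    have : col s ≠ y := fun hs => h ⟨s, hs⟩
    simp [colMat, colRepl_X, this]

/-- The derivation replacing the row `q` by the row `p`, on the positions in `s`. -/
def rowRepl (s : Finset (Bool × ℕ)) (p q : Fin n) : Derivation ℂ (FPoly n) (FPoly n) :=
  ∑ y ∈ s, (X (y, p) : FPoly n) • pderiv (y, q)

theorem rowRepl_apply (s : Finset (Bool × ℕ)) (p q : Fin n) (f : FPoly n) :
    rowRepl s p q f = ∑ y ∈ s, X (y, p) * pderiv (y, q) f := by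
  simp [rowRepl, derivation_sum_apply]

theorem rowRepl_X {s : Finset (Bool × ℕ)} (p q : Fin n) {y : Bool × ℕ} (hy : y ∈ s) (c : Fin n) :
    rowRepl s p q (X (y, c)) = if c = q then X (y, p) else 0 := by
  rw [rowRepl_apply, Finset.sum_eq_single y]
  · rw [pderiv_X]
    by_cases h : c = q <;> simp [h]
  · intro b _ hb
    rw [pderiv_X_of_ne (by simp [hb.symm]), mul_zero]
  · exact fun h => absurd hy h

theorem rowRepl_det_eq_zero {l : ℕ} (hl : l ≤ n) (col : Fin l → Bool × ℕ)
    {s : Finset (Bool × ℕ)} (hs : ∀ t, col t ∈ s) {p q : Fin n} (hpq : p < q) :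
    rowRepl s p q (colMat hl col).det = 0 := by
  rw [derivation_det_row]
  refine Finset.sum_eq_zero fun k _ => ?_
  by_cases hk : Fin.castLE hl k = q
  · have hpk : (p : ℕ) < k := by
      have := congrArg Fin.val hk
      simp only [Fin.val_castLE] at this
      have h2 : (p : ℕ) < q := hpq
      omega
    have hne : k ≠ ⟨p, hpk.trans k.2⟩ := fun h => by
      have := congrArg Fin.val h
      simp at this
      omega
    refine Matrix.det_zero_of_row_eq hne ?_
    rw [Matrix.updateRow_self, Matrix.updateRow_ne hne.symm]
    ext1 t
    have hp : Fin.castLE hl ⟨p, hpk.trans k.2⟩ = p := rfl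
    simp [colMat, rowRepl_X _ _ (hs t), hk, hp]
  · exact Matrix.det_eq_zero_of_row_eq_zero k fun t => by
      simp [colMat, rowRepl_X _ _ (hs t), hk]

theorem rowRepl_self_det {l : ℕ} (hl : l ≤ n) (col : Fin l → Bool × ℕ)
    {s : Finset (Bool × ℕ)} (hs : ∀ t, col t ∈ s) (p : Fin n) :
    rowRepl s p p (colMat hl col).det
      = (if (p : ℕ) < l then (1 : ℂ) else 0) • (colMat hl col).det := by
  rw [derivation_det_row]
  split_ifs with h
  · rw [Finset.sum_eq_single ⟨p, h⟩, one_smul]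
    · congr 1
      convert Matrix.updateRow_eq_self (colMat hl col) ⟨p, h⟩ using 2
      ext1 t
      simp [colMat, rowRepl_X _ _ (hs t), Fin.castLE]
    · intro k _ hk
      refine Matrix.det_eq_zero_of_row_eq_zero k fun t => ?_
      have : Fin.castLE hl k ≠ p := fun h => hk (Fin.ext (by simpa using congrArg Fin.val h))
      simp [colMat, rowRepl_X _ _ (hs t), this]
    · simp
  · rw [zero_smul]
    refine Finset.sum_eq_zero fun k _ => Matrix.det_eq_zero_of_row_eq_zero k fun t => ?_
    have : Fin.castLE hl k ≠ p := fun hk => h (by rw [← hk]; simp)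
    simp [colMat, rowRepl_X _ _ (hs t), this]

/-- Indicator column of the row `c`. -/
def rowInd {l : ℕ} (hl : l ≤ n) (c : Fin n) : Fin l → FPoly n :=
  fun k => if Fin.castLE hl k = c then 1 else 0

theorem pderiv_det_of_notMem {l : ℕ} (hl : l ≤ n) {col : Fin l → Bool × ℕ} {y : Bool × ℕ}
    (hy : y ∉ Set.range col) (c : Fin n) : pderiv (y, c) (colMat hl col).det = 0 := by
  rw [derivation_det]
  refine Finset.sum_eq_zero fun t _ => Matrix.det_eq_zero_of_column_eq_zero t fun k => ?_
  have : col t ≠ y := fun h => hy ⟨t, h⟩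
  simp only [Matrix.updateCol_self, colMat, Matrix.of_apply]
  rw [pderiv_X_of_ne (by simp [this])]

theorem pderiv_det_of_row {l : ℕ} (hl : l ≤ n) (col : Fin l → Bool × ℕ) (y : Bool × ℕ)
    {c : Fin n} (hc : l ≤ c) : pderiv (y, c) (colMat hl col).det = 0 := by
  rw [derivation_det]
  refine Finset.sum_eq_zero fun t _ => Matrix.det_eq_zero_of_column_eq_zero t fun k => ?_
  have : Fin.castLE hl k ≠ c := fun h => by
    have := congrArg Fin.val h
    simp at this
    omega
  simp only [Matrix.updateCol_self, colMat, Matrix.of_apply]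
  rw [pderiv_X_of_ne (by simp [this])]

theorem pderiv_det_updateCol {l : ℕ} (hl : l ≤ n) {col : Fin l → Bool × ℕ}
    (hc : Function.Injective col) (t : Fin l) (c : Fin n) :
    pderiv (col t, c) (colMat hl col).det
      = ((colMat hl col).updateCol t (rowInd hl c)).det := by
  rw [derivation_det, Finset.sum_eq_single t]
  · congr 2
    ext1 k
    simp only [colMat, Matrix.of_apply, pderiv_X, rowInd]
    by_cases h : Fin.castLE hl k = c <;> simp [h]
  · intro s _ hs
    refine Matrix.det_eq_zero_of_column_eq_zero s fun k => ?_
    simp only [Matrix.updateCol_self, colMat, Matrix.of_apply]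
    rw [pderiv_X_of_ne (by simp [hc.ne hs])]
  · simp

theorem pderiv_rowInd {l : ℕ} (hl : l ≤ n) (v : FVar n) (c : Fin n) (k : Fin l) :
    pderiv v (rowInd hl c k) = 0 := by
  unfold rowInd
  split_ifs <;> simp

theorem pderiv_pderiv_det_self {l : ℕ} (hl : l ≤ n) {col : Fin l → Bool × ℕ}
    (hc : Function.Injective col) (t : Fin l) (c c' : Fin n) :
    pderiv (col t, c') (pderiv (col t, c) (colMat hl col).det) = 0 := by
  rw [pderiv_det_updateCol hl hc, derivation_det]
  refine Finset.sum_eq_zero fun s _ => Matrix.det_eq_zero_of_column_eq_zero s fun k => ?_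
  rw [Matrix.updateCol_self]
  by_cases hs : s = t
  · subst hs
    rw [Matrix.updateCol_self, pderiv_rowInd]
  · rw [Matrix.updateCol_ne hs]
    simp only [colMat, Matrix.of_apply]
    rw [pderiv_X_of_ne (by simp [hc.ne hs])]

theorem pderiv_pderiv_det_ne {l : ℕ} (hl : l ≤ n) {col : Fin l → Bool × ℕ}
    (hc : Function.Injective col) {t t' : Fin l} (htt : t ≠ t') (c c' : Fin n) :
    pderiv (col t', c') (pderiv (col t, c) (colMat hl col).det)
      = (((colMat hl col).updateCol t (rowInd hl c)).updateCol t' (rowInd hl c')).det := by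
  rw [pderiv_det_updateCol hl hc, derivation_det, Finset.sum_eq_single t']
  · congr 2
    ext1 k
    rw [Matrix.updateCol_ne htt.symm]
    simp only [colMat, Matrix.of_apply, pderiv_X, rowInd]
    by_cases h : Fin.castLE hl k = c' <;> simp [h]
  · intro s _ hs
    refine Matrix.det_eq_zero_of_column_eq_zero s fun k => ?_
    rw [Matrix.updateCol_self]
    by_cases hst : s = t
    · subst hst
      rw [Matrix.updateCol_self, pderiv_rowInd]
    · rw [Matrix.updateCol_ne hst]
      simp only [colMat, Matrix.of_apply]
      rw [pderiv_X_of_ne (by simp [hc.ne hs])]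
  · simp

theorem det_updateCol_updateCol_swap {ι P : Type*} [Fintype ι] [DecidableEq ι] [CommRing P]
    (M : Matrix ι ι P) {t t' : ι} (htt : t ≠ t') (a b : ι → P) :
    ((M.updateCol t a).updateCol t' b).det = -((M.updateCol t b).updateCol t' a).det := by
  have h := Matrix.det_permute' (Equiv.swap t t') ((M.updateCol t b).updateCol t' a)
  rw [Equiv.Perm.sign_swap htt] at h
  simp only [Units.val_neg, Units.val_one, Int.cast_neg, Int.cast_one, neg_mul, one_mul] at h
  rw [← h]
  congr 1
  ext i j
  simp only [Matrix.submatrix_apply, id]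
  by_cases h1 : j = t
  · subst h1
    simp [htt]
  · by_cases h2 : j = t'
    · subst h2
      simp [htt]
    · simp [h1, h2, Equiv.swap_apply_of_ne_of_ne h1 h2]

theorem pderiv_pderiv_det_antisymm {l : ℕ} (hl : l ≤ n) {col : Fin l → Bool × ℕ}
    (hc : Function.Injective col) (y z : Bool × ℕ) (c c' : Fin n) :
    pderiv (y, c) (pderiv (z, c') (colMat hl col).det)
      = -pderiv (y, c') (pderiv (z, c) (colMat hl col).det) := by
  by_cases hz : z ∈ Set.range col
  · obtain ⟨t, rfl⟩ := hz
    by_cases hy : y ∈ Set.range col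
    · obtain ⟨t', rfl⟩ := hy
      by_cases htt : t = t'
      · subst htt
        rw [pderiv_pderiv_det_self hl hc, pderiv_pderiv_det_self hl hc, neg_zero]
      · rw [pderiv_pderiv_det_ne hl hc htt, pderiv_pderiv_det_ne hl hc htt,
          det_updateCol_updateCol_swap _ htt]
    · have hcomm : ∀ e e' : Fin n, pderiv (y, e) (pderiv (col t, e') (colMat hl col).det) = 0 := by
        intro e e'
        rw [pderiv_det_updateCol hl hc, derivation_det]
        refine Finset.sum_eq_zero fun s _ => Matrix.det_eq_zero_of_column_eq_zero s fun k => ?_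
        rw [Matrix.updateCol_self]
        by_cases hst : s = t
        · subst hst
          rw [Matrix.updateCol_self, pderiv_rowInd]
        · rw [Matrix.updateCol_ne hst]
          have : col s ≠ y := fun h => hy ⟨s, h⟩
          simp only [colMat, Matrix.of_apply]
          rw [pderiv_X_of_ne (by simp [this])]
      rw [hcomm, hcomm, neg_zero]
  · rw [pderiv_det_of_notMem hl hz, pderiv_det_of_notMem hl hz]
    simp

/-- The contraction of the columns `y` and `z` with the split symmetric form. -/
def contract (y z : Bool × ℕ) (f : FPoly n) : FPoly n :=
  ∑ c : Fin n, pderiv (y, c) (pderiv (z, Fin.rev c) f)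

theorem contract_det {l : ℕ} (hl : l ≤ n) {col : Fin l → Bool × ℕ}
    (hc : Function.Injective col) (y z : Bool × ℕ) : contract y z (colMat hl col).det = 0 := by
  have h : contract y z (colMat hl col).det = -contract y z (colMat hl col).det := by
    conv_lhs => rw [contract, ← Equiv.sum_comp Fin.revPerm]
    rw [contract, ← Finset.sum_neg_distrib]
    refine Finset.sum_congr rfl fun c _ => ?_
    rw [Fin.revPerm_apply, Fin.rev_rev, pderiv_pderiv_det_antisymm hl hc]
  exact self_eq_neg.1 h

theorem contract_mul {f g : FPoly n} {a b : ℕ} (hab : a + b ≤ n) (haa : a + a ≤ n)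
    (hf : ∀ (y : Bool × ℕ) (c : Fin n), a ≤ c → pderiv (y, c) f = 0)
    (hg : ∀ (y : Bool × ℕ) (c : Fin n), b ≤ c → pderiv (y, c) g = 0)
    (y z : Bool × ℕ) (h : contract y z g = 0) : contract y z (f * g) = 0 := by
  have key : contract y z (f * g) = f * contract y z g := by
    rw [contract, contract, Finset.mul_sum]
    refine Finset.sum_congr rfl fun c _ => ?_
    have hr : (Fin.rev c : ℕ) = n - (c + 1) := Fin.val_rev c
    rw [pderiv_mul, map_add, pderiv_mul, pderiv_mul]
    have hcn := c.2
    by_cases h1 : a ≤ c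
    · rw [hf y c h1]
      by_cases h2 : a ≤ (Fin.rev c : ℕ)
      · rw [hf z _ h2]
        simp
      · rw [hg y c (by omega)]
        have hcomm : pderiv (y, c) (pderiv (z, Fin.rev c) f) = 0 := by
          rw [pderiv_pderiv_comm, hf y c h1, map_zero]
        rw [hcomm]
        simp
    · rw [hf z _ (by omega), hg z _ (by omega)]
      simp
  rw [key, h, mul_zero]

end DeterminantDerivations

namespace WCtx

open MvPolynomial

variable (C : WCtx)

instance : IsScalarTower ℂ C.W C.F := inferInstanceAs (IsScalarTower ℂ C.W (C.W ⧸ C.vacIdeal))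

theorem psi0_mul_psi0 (i j : Fin C.NN) (k l : ℤ) :
    C.psi0 i k * C.psi0 j l = C.psi0 j l * C.psi0 i k := by
  have h := RingQuot.mkAlgHom_rel ℂ (rel.comm_psi (C := C) i j k l)
  rw [map_mul, map_mul] at h
  exact h

theorem psibar0_mul_psibar0 (i j : Fin C.NN) (k l : ℤ) :
    C.psibar0 i k * C.psibar0 j l = C.psibar0 j l * C.psibar0 i k := by
  have h := RingQuot.mkAlgHom_rel ℂ (rel.comm_psibar (C := C) i j k l)
  rw [map_mul, map_mul] at h
  exact h

theorem psibar0_mul_psi0 (i j : Fin C.NN) (k l : ℤ) :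
    C.psibar0 i k * C.psi0 j l
      = C.psi0 j l * C.psibar0 i k + if i = j ∧ k + l + C.sig = 0 then 1 else 0 := by
  have h := RingQuot.mkAlgHom_rel ℂ (rel.mixed (C := C) i j k l)
  rw [map_mul, map_add, map_mul, apply_ite (RingQuot.mkAlgHom ℂ C.rel), map_one, map_zero] at h
  exact h

theorem m_pos : (0 : ℤ) < C.m := by exact_mod_cast C.hm

theorem flat_lt (c : Fin C.n) {i : ℕ} (hi : i < C.m) : i + c * C.m < C.NN := by
  have h : (c + 1 : ℕ) * C.m ≤ C.n * C.m := Nat.mul_le_mul_right _ c.2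
  rw [NN, mul_comm C.m]
  rw [add_mul, one_mul] at h
  omega

theorem emod_toNat_lt (t : ℤ) : (t % C.m).toNat < C.m := by
  have h1 := Int.emod_nonneg t C.m_pos.ne'
  have h2 := Int.emod_lt_of_pos t C.m_pos
  omega

theorem PhiW_eq (c : Fin C.n) (t : ℤ) :
    C.PhiW (c + 1) t = C.psi0 ⟨((-t - 1) % C.m).toNat + c * C.m, C.flat_lt c (C.emod_toNat_lt _)⟩
      (-((-t - 1) / C.m) - C.sig) := by
  have h1 := C.flat_lt c (C.emod_toNat_lt (-t - 1))
  have h2 : (t + (-t - 1) % C.m + 1) / C.m = -((-t - 1) / C.m) := by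
    have := Int.emod_add_mul_ediv (-t - 1) C.m
    rw [show t + (-t - 1) % C.m + 1 = C.m * (-((-t - 1) / C.m)) by linarith]
    exact Int.mul_ediv_cancel_left _ C.m_pos.ne'
  unfold PhiW psiF
  simp only [show ∀ x : ℤ, Int.emod x C.m = x % C.m from fun _ => rfl, Nat.add_sub_cancel, h2]
  rw [dif_pos ⟨by omega, by omega⟩]
  congr 2
  omega

theorem PhibarW_eq (c : Fin C.n) (t : ℤ) :
    C.PhibarW (c + 1) t = C.psibar0 ⟨(t % C.m).toNat + c * C.m, C.flat_lt c (C.emod_toNat_lt _)⟩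
      (t / C.m) := by
  have h1 := C.flat_lt c (C.emod_toNat_lt t)
  have h2 : (t - t % C.m) / C.m = t / C.m := by
    have := Int.emod_add_mul_ediv t C.m
    rw [show t - t % C.m = C.m * (t / C.m) by linarith]
    exact Int.mul_ediv_cancel_left _ C.m_pos.ne'
  unfold PhibarW psibarF
  simp only [show ∀ x : ℤ, Int.emod x C.m = x % C.m from fun _ => rfl, Nat.add_sub_cancel, h2]
  rw [dif_pos ⟨by omega, by omega⟩]
  congr 2
  omega

theorem psiS_eq {i : ℕ} (hi : 1 ≤ i) (him : i ≤ C.m) (c : Fin C.n) (k : ℤ) :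
    C.psiS i (c + 1) k = C.PhiW (c + 1) ((k + C.sig) * C.m - i) := by
  have h1 := C.flat_lt c (show i - 1 < C.m by omega)
  have h2 : -((k + C.sig) * C.m - i) - 1 = ((i - 1 : ℕ) : ℤ) + C.m * (-(k + C.sig)) := by
    push_cast [hi]
    ring
  have h3 : ((i - 1 : ℕ) : ℤ) < C.m := by omega
  rw [PhiW_eq]
  simp only [h2, Int.add_mul_emod_self_left, Int.add_mul_ediv_left _ _ C.m_pos.ne',
    Int.emod_eq_of_lt (Int.natCast_nonneg (i - 1)) h3,
    Int.ediv_eq_zero_of_lt (Int.natCast_nonneg (i - 1)) h3, Int.toNat_natCast]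
  rw [psiS, psiF, Nat.add_sub_cancel, dif_pos ⟨by omega, by omega⟩]
  congr 2
  · omega
  · ring

theorem psibarS_eq {i : ℕ} (hi : 1 ≤ i) (him : i ≤ C.m) (c : Fin C.n) (k : ℤ) :
    C.psibarS i (c + 1) k = C.PhibarW (c + 1) (k * C.m + i - 1) := by
  have h1 := C.flat_lt c (show i - 1 < C.m by omega)
  have h2 : k * C.m + i - 1 = ((i - 1 : ℕ) : ℤ) + C.m * k := by
    push_cast [hi]
    ring
  have h3 : ((i - 1 : ℕ) : ℤ) < C.m := by omega
  rw [PhibarW_eq]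
  simp only [h2, Int.add_mul_emod_self_left, Int.add_mul_ediv_left _ _ C.m_pos.ne',
    Int.emod_eq_of_lt (Int.natCast_nonneg (i - 1)) h3,
    Int.ediv_eq_zero_of_lt (Int.natCast_nonneg (i - 1)) h3, Int.toNat_natCast]
  rw [psibarS, psibarF, Nat.add_sub_cancel, dif_pos ⟨by omega, by omega⟩]
  congr 2
  · omega
  · ring

theorem flat_inj {c c' : Fin C.n} {i i' : ℕ} (hi : i < C.m) (hi' : i' < C.m)
    (h : i + c * C.m = i' + c' * C.m) : i = i' ∧ c = c' := by
  have h1 := congrArg (· % C.m) h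
  have h2 := congrArg (· / C.m) h
  simp only [Nat.add_mul_mod_self_right, Nat.mod_eq_of_lt hi, Nat.mod_eq_of_lt hi'] at h1
  simp only [Nat.add_mul_div_right _ _ C.hm, Nat.div_eq_of_lt hi, Nat.div_eq_of_lt hi',
    zero_add] at h2
  exact ⟨h1, Fin.ext h2⟩

theorem PhiW_mul_PhiW (c c' : Fin C.n) (s t : ℤ) :
    C.PhiW (c + 1) s * C.PhiW (c' + 1) t = C.PhiW (c' + 1) t * C.PhiW (c + 1) s := by
  simp only [PhiW_eq, psi0_mul_psi0]

theorem PhibarW_mul_PhibarW (c c' : Fin C.n) (s t : ℤ) :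
    C.PhibarW (c + 1) s * C.PhibarW (c' + 1) t = C.PhibarW (c' + 1) t * C.PhibarW (c + 1) s := by
  simp only [PhibarW_eq, psibar0_mul_psibar0]

theorem PhibarW_mul_PhiW (c c' : Fin C.n) (t s : ℤ) :
    C.PhibarW (c + 1) t * C.PhiW (c' + 1) s
      = C.PhiW (c' + 1) s * C.PhibarW (c + 1) t + if c = c' ∧ s + t = -1 then 1 else 0 := by
  rw [PhibarW_eq, PhiW_eq, psibar0_mul_psi0]
  congr 2
  rw [Fin.mk.injEq, eq_iff_iff]
  constructor
  · rintro ⟨h1, h2⟩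
    obtain ⟨h3, h4⟩ := C.flat_inj (C.emod_toNat_lt _) (C.emod_toNat_lt _) h1
    refine ⟨h4, ?_⟩
    have h5 := Int.emod_nonneg t C.m_pos.ne'
    have h6 := Int.emod_nonneg (-s - 1) C.m_pos.ne'
    have h7 := Int.emod_add_mul_ediv t C.m
    have h8 := Int.emod_add_mul_ediv (-s - 1) C.m
    have h9 : t / C.m = (-s - 1) / C.m := by linarith
    have h10 : t % C.m = (-s - 1) % C.m := by omega
    rw [h9, h10] at h7
    linarith
  · rintro ⟨rfl, h⟩
    obtain rfl : t = -s - 1 := by linarith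
    exact ⟨rfl, by ring⟩

/-- The creation operator attached to a variable. -/
def creator (v : FVar C.n) : C.W :=
  if v.1.1 then C.PhiW (v.2 + 1) (-((v.1.2 : ℤ) + 1))
  else C.PhibarW (Fin.rev v.2 + 1) (-((v.1.2 : ℤ) + 1))

theorem creator_true (t : ℕ) (c : Fin C.n) :
    C.creator ((true, t), c) = C.PhiW (c + 1) (-((t : ℤ) + 1)) := rfl

theorem creator_false (t : ℕ) (c : Fin C.n) :
    C.creator ((false, t), c) = C.PhibarW (Fin.rev c + 1) (-((t : ℤ) + 1)) := rfl

theorem PhibarW_commute_PhiW (c c' : Fin C.n) (t s : ℤ) (h : ¬(c = c' ∧ s + t = -1)) :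
    C.PhibarW (c + 1) t * C.PhiW (c' + 1) s = C.PhiW (c' + 1) s * C.PhibarW (c + 1) t := by
  rw [PhibarW_mul_PhiW, if_neg h, add_zero]

theorem creator_mul_creator (v w : FVar C.n) :
    C.creator v * C.creator w = C.creator w * C.creator v := by
  obtain ⟨⟨_ | _, s⟩, c⟩ := v <;> obtain ⟨⟨_ | _, t⟩, d⟩ := w <;>
    simp only [creator_true, creator_false]
  · exact C.PhibarW_mul_PhibarW _ _ _ _
  · exact C.PhibarW_commute_PhiW _ _ _ _ (by omega)
  · exact (C.PhibarW_commute_PhiW _ _ _ _ (by omega)).symm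
  · exact C.PhiW_mul_PhiW _ _ _ _

theorem exists_creatorHom :
    ∃ f : FPoly C.n →ₐ[ℂ] C.W, ∀ v, f (X v) = C.creator v :=
  exists_algHom_of_commute C.creator C.creator_mul_creator

/-- Polynomials in the creation operators. -/
def creatorHom : FPoly C.n →ₐ[ℂ] C.W := C.exists_creatorHom.choose

theorem creatorHom_X (v : FVar C.n) : C.creatorHom (X v) = C.creator v :=
  C.exists_creatorHom.choose_spec v

/-- The polynomial model of the Fock module. -/
def fock : FPoly C.n →ₗ[ℂ] C.F :=
  ((LinearMap.toSpanSingleton C.W C.F C.vac).restrictScalars ℂ) ∘ₗ C.creatorHom.toLinearMap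

theorem fock_apply (p : FPoly C.n) : C.fock p = C.creatorHom p • C.vac := rfl

theorem creator_smul_fock (v : FVar C.n) (p : FPoly C.n) :
    C.creator v • C.fock p = C.fock (X v * p) := by
  rw [fock_apply, fock_apply, map_mul, creatorHom_X, mul_smul]

/-- An operator killing the vacuum and whose commutators with the creation operators are scalar
acts on the polynomial model by a derivation. -/
theorem annihilator_smul_fock (u : C.W) (hu : u • C.vac = 0)
    (D : Derivation ℂ (FPoly C.n) (FPoly C.n))
    (h : ∀ v, u * C.creator v = C.creator v * u + C.creatorHom (D (X v))) (p : FPoly C.n) :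
    u • C.fock p = C.fock (D p) := by
  have key : u * C.creatorHom p = C.creatorHom p * u + C.creatorHom (D p) := by
    induction p using MvPolynomial.induction_on with
    | C a =>
      rw [← algebraMap_eq, AlgHom.commutes, D.map_algebraMap, map_zero, add_zero,
        Algebra.commutes]
    | add p q hp hq => rw [map_add, map_add, map_add, mul_add, add_mul, hp, hq]; abel
    | mul_X p v hp =>
      rw [D.leibniz, map_add, smul_eq_mul, smul_eq_mul, map_mul, map_mul, map_mul, creatorHom_X,
        ← mul_assoc, hp, add_mul, mul_assoc, h, mul_add, ← mul_assoc]
      have hc : C.creatorHom (D p) * C.creator v = C.creator v * C.creatorHom (D p) := by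
        rw [← creatorHom_X, ← map_mul, ← map_mul, mul_comm]
      rw [hc]
      abel
  rw [fock_apply, ← mul_smul, key, add_smul, mul_smul, hu, smul_zero, zero_add, fock_apply]

theorem vac_eq_zero {w : C.W} (hw : w ∈ C.vacIdeal) : w • C.vac = 0 := by
  change Submodule.Quotient.mk (w • (1 : C.W)) = (0 : C.W ⧸ C.vacIdeal)
  rw [Submodule.Quotient.mk_eq_zero, smul_eq_mul, mul_one]
  exact hw

theorem PhiW_smul_vac (c : Fin C.n) {s : ℤ} (hs : 0 ≤ s) : C.PhiW (c + 1) s • C.vac = 0 := by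
  rw [PhiW_eq]
  refine C.vac_eq_zero (Submodule.subset_span (Or.inl ⟨_, _, ?_, Or.inl rfl⟩))
  have h : (-s - 1) / (C.m : ℤ) < 0 := Int.ediv_neg_of_neg_of_pos (by linarith) C.m_pos
  rcases C.hsig with h' | h' <;> rw [h'] <;> omega

theorem PhibarW_smul_vac (c : Fin C.n) {t : ℤ} (ht : 0 ≤ t) :
    C.PhibarW (c + 1) t • C.vac = 0 := by
  rw [PhibarW_eq]
  refine C.vac_eq_zero (Submodule.subset_span ?_)
  have h : 0 ≤ t / (C.m : ℤ) := Int.ediv_nonneg ht C.m_pos.le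
  rcases C.hsig with h' | h'
  · rcases h.eq_or_lt with h0 | h0
    · exact Or.inr ⟨h', _, by rw [← h0]⟩
    · exact Or.inl ⟨_, _, by omega, Or.inr rfl⟩
  · exact Or.inl ⟨_, _, by omega, Or.inr rfl⟩

theorem PhiW_neg_smul_fock (c : Fin C.n) {s : ℤ} (hs : s < 0) (p : FPoly C.n) :
    C.PhiW (c + 1) s • C.fock p = C.fock (X ((true, (-s - 1).toNat), c) * p) := by
  rw [← creator_smul_fock, creator_true]
  congr 3
  omega

theorem PhibarW_neg_smul_fock (c : Fin C.n) {t : ℤ} (ht : t < 0) (p : FPoly C.n) :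
    C.PhibarW (c + 1) t • C.fock p = C.fock (X ((false, (-t - 1).toNat), Fin.rev c) * p) := by
  rw [← creator_smul_fock, creator_false, Fin.rev_rev]
  congr 3
  omega

theorem PhiW_nonneg_smul_fock (c : Fin C.n) {s : ℤ} (hs : 0 ≤ s) (p : FPoly C.n) :
    C.PhiW (c + 1) s • C.fock p = -C.fock (pderiv ((false, s.toNat), Fin.rev c) p) := by
  rw [C.annihilator_smul_fock _ (C.PhiW_smul_vac c hs) (-pderiv ((false, s.toNat), Fin.rev c)),
    Derivation.neg_apply, map_neg]
  rintro ⟨⟨_ | _, t⟩, d⟩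
  · rw [creator_false, PhibarW_mul_PhiW, Derivation.neg_apply, pderiv_X, add_assoc]
    by_cases h : Fin.rev d = c ∧ s + -((t : ℤ) + 1) = -1
    · obtain ⟨rfl, h2⟩ := h
      have ht : s.toNat = t := by omega
      rw [if_pos ⟨rfl, h2⟩, ht, Fin.rev_rev, Pi.single_eq_same, map_neg, map_one, add_neg_cancel,
        add_zero]
    · rw [if_neg h, Pi.single_apply, if_neg]
      · simp
      · intro h'
        simp only [Prod.mk.injEq, true_and] at h'
        exact h ⟨by rw [h'.2, Fin.rev_rev], by omega⟩
  · rw [creator_true, PhiW_mul_PhiW, Derivation.neg_apply, pderiv_X_of_ne (by simp)]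
    simp

theorem PhibarW_nonneg_smul_fock (c : Fin C.n) {t : ℤ} (ht : 0 ≤ t) (p : FPoly C.n) :
    C.PhibarW (c + 1) t • C.fock p = C.fock (pderiv ((true, t.toNat), c) p) := by
  rw [C.annihilator_smul_fock _ (C.PhibarW_smul_vac c ht) (pderiv ((true, t.toNat), c))]
  rintro ⟨⟨_ | _, s⟩, d⟩
  · rw [creator_false, PhibarW_mul_PhibarW, pderiv_X_of_ne (by simp)]
    simp
  · rw [creator_true, PhibarW_mul_PhiW, pderiv_X]
    by_cases h : c = d ∧ -((s : ℤ) + 1) + t = -1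
    · obtain ⟨rfl, h2⟩ := h
      have ht : t.toNat = s := by omega
      rw [if_pos ⟨rfl, h2⟩, ht, Pi.single_eq_same, map_one]
    · rw [if_neg h, Pi.single_apply, if_neg]
      · simp
      · intro h'
        simp only [Prod.mk.injEq, true_and] at h'
        exact h ⟨h'.2.symm, by omega⟩

/-- The action of `φ^c_s` on polynomials. -/
def phiEnd (c : Fin C.n) (s : ℤ) : Module.End ℂ (FPoly C.n) :=
  if s < 0 then LinearMap.mulLeft ℂ (X ((true, (-s - 1).toNat), c))
  else -(pderiv ((false, s.toNat), Fin.rev c)).toLinearMap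

/-- The action of `φ̄^c_t` on polynomials. -/
def phibarEnd (c : Fin C.n) (t : ℤ) : Module.End ℂ (FPoly C.n) :=
  if t < 0 then LinearMap.mulLeft ℂ (X ((false, (-t - 1).toNat), Fin.rev c))
  else (pderiv ((true, t.toNat), c)).toLinearMap

theorem phiEnd_mul_phiEnd (c d : Fin C.n) (s t : ℤ) :
    C.phiEnd c s * C.phiEnd d t = C.phiEnd d t * C.phiEnd c s := by
  refine LinearMap.ext fun p => ?_
  unfold phiEnd
  split_ifs
  · simp [mul_left_comm]
  · simp
  · simp
  · simp [pderiv_pderiv_comm ((false, s.toNat), Fin.rev c)]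

theorem phibarEnd_mul_phibarEnd (c d : Fin C.n) (s t : ℤ) :
    C.phibarEnd c s * C.phibarEnd d t = C.phibarEnd d t * C.phibarEnd c s := by
  refine LinearMap.ext fun p => ?_
  unfold phibarEnd
  split_ifs
  · simp [mul_left_comm]
  · simp
  · simp
  · simp [pderiv_pderiv_comm ((true, s.toNat), c)]

theorem phibarEnd_mul_phiEnd (c d : Fin C.n) (t s : ℤ) :
    C.phibarEnd c t * C.phiEnd d s
      = C.phiEnd d s * C.phibarEnd c t + if c = d ∧ s + t = -1 then 1 else 0 := by
  refine LinearMap.ext fun p => ?_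
  unfold phiEnd phibarEnd
  by_cases ht : t < 0 <;> by_cases hs : s < 0
  · rw [if_pos ht, if_pos hs, if_neg (by omega)]
    simp [mul_left_comm]
  · rw [if_pos ht, if_neg hs]
    by_cases h : c = d ∧ s + t = -1
    · obtain ⟨rfl, h⟩ := h
      have h1 : (-t - 1).toNat = s.toNat := by omega
      rw [if_pos ⟨rfl, h⟩, h1]
      simp
    · rw [if_neg h]
      have h1 : ((false, (-t - 1).toNat), Fin.rev c) ≠ ((false, s.toNat), Fin.rev d) := by
        intro h'
        simp only [Prod.mk.injEq, true_and, Fin.rev_inj] at h'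
        exact h ⟨h'.2, by omega⟩
      generalize (-t - 1).toNat = a at h1 ⊢
      simp [pderiv_X_of_ne h1]
  · rw [if_neg ht, if_pos hs]
    by_cases h : c = d ∧ s + t = -1
    · obtain ⟨rfl, h⟩ := h
      have h1 : (-s - 1).toNat = t.toNat := by omega
      rw [if_pos ⟨rfl, h⟩, h1]
      simp
    · rw [if_neg h]
      have h1 : ((true, (-s - 1).toNat), d) ≠ ((true, t.toNat), c) := by
        intro h'
        simp only [Prod.mk.injEq, true_and] at h'
        exact h ⟨h'.2.symm, by omega⟩
      generalize (-s - 1).toNat = a at h1 ⊢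
      simp [pderiv_X_of_ne h1]
  · rw [if_neg ht, if_neg hs, if_neg (by omega)]
    simp [pderiv_pderiv_comm ((true, t.toNat), c)]

theorem row_lt (i : Fin C.NN) : (i : ℕ) / C.m < C.n := by
  rw [Nat.div_lt_iff_lt_mul C.hm, mul_comm]
  exact i.2

/-- The polynomial action of a generator. -/
def genEnd : C.Gen → Module.End ℂ (FPoly C.n)
  | (Sum.inl i, k) => C.phiEnd ⟨i / C.m, C.row_lt i⟩ ((k + C.sig) * C.m - ((i : ℕ) % C.m : ℕ) - 1)
  | (Sum.inr i, k) => C.phibarEnd ⟨i / C.m, C.row_lt i⟩ (k * C.m + ((i : ℕ) % C.m : ℕ))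

theorem genEnd_pairing (i j : Fin C.NN) (k l : ℤ) :
    ((⟨i / C.m, C.row_lt i⟩ : Fin C.n) = ⟨j / C.m, C.row_lt j⟩ ∧
      ((l + C.sig) * C.m - ((j : ℕ) % C.m : ℕ) - 1) + (k * C.m + ((i : ℕ) % C.m : ℕ)) = -1)
      ↔ (i = j ∧ k + l + C.sig = 0) := by
  have hi := Nat.mod_add_div (i : ℕ) C.m
  have hj := Nat.mod_add_div (j : ℕ) C.m
  have hi' : (((i : ℕ) % C.m : ℕ) : ℤ) < C.m := by exact_mod_cast Nat.mod_lt (i : ℕ) C.hm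
  have hj' : (((j : ℕ) % C.m : ℕ) : ℤ) < C.m := by exact_mod_cast Nat.mod_lt (j : ℕ) C.hm
  rw [Fin.mk.injEq]
  constructor
  · rintro ⟨h1, h2⟩
    have h3 : (k + l + C.sig) * C.m = (((j : ℕ) % C.m : ℕ) : ℤ) - ((i : ℕ) % C.m : ℕ) := by
      linarith
    have h4 : k + l + C.sig = 0 := by
      by_contra h
      rcases lt_or_gt_of_ne h with h | h
      · nlinarith [C.m_pos]
      · nlinarith [C.m_pos]
    rw [h4, zero_mul] at h3
    have h5 : (j : ℕ) % C.m = (i : ℕ) % C.m := by omega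
    refine ⟨Fin.ext ?_, h4⟩
    rw [← hi, ← hj, h1, h5]
  · rintro ⟨rfl, h⟩
    refine ⟨rfl, ?_⟩
    linear_combination (C.m : ℤ) * h

/-- The polynomial representation of the enlarged Weyl algebra. -/
def rep : C.W →ₐ[ℂ] Module.End ℂ (FPoly C.n) :=
  RingQuot.liftAlgHom ℂ ⟨FreeAlgebra.lift ℂ C.genEnd, by
    intro x y h
    cases h with
    | comm_psi i j k l =>
      rw [map_mul, map_mul, FreeAlgebra.lift_ι_apply, FreeAlgebra.lift_ι_apply]
      exact C.phiEnd_mul_phiEnd _ _ _ _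
    | comm_psibar i j k l =>
      rw [map_mul, map_mul, FreeAlgebra.lift_ι_apply, FreeAlgebra.lift_ι_apply]
      exact C.phibarEnd_mul_phibarEnd _ _ _ _
    | mixed i j k l =>
      rw [map_mul, map_add, map_mul, apply_ite (FreeAlgebra.lift ℂ C.genEnd), map_one, map_zero,
        FreeAlgebra.lift_ι_apply, FreeAlgebra.lift_ι_apply]
      refine (C.phibarEnd_mul_phiEnd _ _ _ _).trans ?_
      congr 2
      exact propext (C.genEnd_pairing i j k l)⟩

theorem rep_psi0 (i : Fin C.NN) (k : ℤ) : C.rep (C.psi0 i k) = C.genEnd (Sum.inl i, k) :=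
  (RingQuot.liftAlgHom_mkAlgHom_apply _ _ _ _).trans (FreeAlgebra.lift_ι_apply _ _)

theorem rep_psibar0 (i : Fin C.NN) (k : ℤ) : C.rep (C.psibar0 i k) = C.genEnd (Sum.inr i, k) :=
  (RingQuot.liftAlgHom_mkAlgHom_apply _ _ _ _).trans (FreeAlgebra.lift_ι_apply _ _)

theorem rep_PhiW (c : Fin C.n) (s : ℤ) : C.rep (C.PhiW (c + 1) s) = C.phiEnd c s := by
  have h1 := C.emod_toNat_lt (-s - 1)
  have h2 := Int.emod_nonneg (-s - 1) C.m_pos.ne'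
  rw [PhiW_eq, rep_psi0, genEnd]
  simp only [Nat.add_mul_div_right _ _ C.hm, Nat.div_eq_of_lt h1, Nat.add_mul_mod_self_right,
    Nat.mod_eq_of_lt h1, zero_add, Fin.eta, Int.toNat_of_nonneg h2]
  congr 1
  linarith [Int.emod_add_mul_ediv (-s - 1) C.m]

theorem rep_PhibarW (c : Fin C.n) (t : ℤ) : C.rep (C.PhibarW (c + 1) t) = C.phibarEnd c t := by
  have h1 := C.emod_toNat_lt t
  have h2 := Int.emod_nonneg t C.m_pos.ne'
  rw [PhibarW_eq, rep_psibar0, genEnd]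
  simp only [Nat.add_mul_div_right _ _ C.hm, Nat.div_eq_of_lt h1, Nat.add_mul_mod_self_right,
    Nat.mod_eq_of_lt h1, zero_add, Fin.eta, Int.toNat_of_nonneg h2]
  congr 1
  linarith [Int.emod_add_mul_ediv t C.m]

theorem rep_creator (v : FVar C.n) : C.rep (C.creator v) = LinearMap.mulLeft ℂ (X v) := by
  obtain ⟨⟨_ | _, s⟩, c⟩ := v
  · rw [creator_false, rep_PhibarW, phibarEnd, if_pos (by omega), Fin.rev_rev]
    congr 4
    omega
  · rw [creator_true, rep_PhiW, phiEnd, if_pos (by omega)]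
    congr 4
    omega

theorem rep_creatorHom (p : FPoly C.n) : C.rep (C.creatorHom p) = Algebra.lmul ℂ (FPoly C.n) p := by
  have h : C.rep.comp C.creatorHom = Algebra.lmul ℂ (FPoly C.n) := by
    refine MvPolynomial.algHom_ext fun v => ?_
    rw [AlgHom.comp_apply, creatorHom_X, rep_creator]
    rfl
  exact DFunLike.congr_fun h p

theorem rep_vacIdeal {w : C.W} (hw : w ∈ C.vacIdeal) : C.rep w 1 = 0 := by
  have hphi : ∀ (c : Fin C.n) (s : ℤ), 0 ≤ s → C.phiEnd c s 1 = 0 := fun c s hs => by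
    rw [phiEnd, if_neg (by omega)]
    simp
  have hphibar : ∀ (c : Fin C.n) (t : ℤ), 0 ≤ t → C.phibarEnd c t 1 = 0 := fun c t ht => by
    rw [phibarEnd, if_neg (by omega)]
    simp
  have hm := C.m_pos
  induction hw using Submodule.span_induction with
  | mem x hx =>
    rcases hx with ⟨i, k, hk, rfl | rfl⟩ | ⟨hs, i, rfl⟩
    · rw [rep_psi0]
      refine hphi _ _ ?_
      have h1 : 1 ≤ k + C.sig := by rcases C.hsig with h | h <;> omega
      have h2 : (((i : ℕ) % C.m : ℕ) : ℤ) < C.m := by exact_mod_cast Nat.mod_lt (i : ℕ) C.hm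
      nlinarith
    · rw [rep_psibar0]
      refine hphibar _ _ ?_
      have h1 : 0 ≤ k := by rcases C.hsig with h | h <;> omega
      positivity
    · rw [rep_psibar0]
      refine hphibar _ _ ?_
      positivity
  | zero => simp
  | add x y _ _ hx hy => rw [map_add, LinearMap.add_apply, hx, hy, add_zero]
  | smul a x _ hx => rw [smul_eq_mul, map_mul, Module.End.mul_apply, hx, map_zero]

theorem fock_ne_zero {p : FPoly C.n} (hp : p ≠ 0) : C.fock p ≠ 0 := by
  intro h
  have h1 : C.creatorHom p ∈ C.vacIdeal := by
    rw [← mul_one (C.creatorHom p), ← smul_eq_mul, ← Submodule.Quotient.mk_eq_zero]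
    exact h
  have h2 := C.rep_vacIdeal h1
  rw [rep_creatorHom] at h2
  exact hp (by simpa using h2)

theorem lb_cases {l : ℕ} (hl : 1 ≤ l) :
    ∃ w v : ℕ, v < C.m ∧ C.lb1 l + C.lb2 l = l ∧
      ((C.lb1 l = w * C.m + (v + 1) ∧ C.lb2 l = w * C.m) ∨
        (C.lb1 l = (w + 1) * C.m ∧ C.lb2 l = w * C.m + (v + 1))) := by
  have h1 := Nat.mod_add_div (l - 1) C.m
  have h2 := Nat.mod_add_div ((l - 1) / C.m) 2
  refine ⟨(l - 1) / C.m / 2, (l - 1) % C.m, Nat.mod_lt _ C.hm, ?_⟩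
  unfold lb2 lb1
  generalize (l - 1) % C.m = v at h1 ⊢
  generalize (l - 1) / C.m = u at h1 h2 ⊢
  have h3 := Nat.mod_lt u two_pos
  split_ifs with h
  · have h4 : C.m * u = u / 2 * C.m + u / 2 * C.m := by
      conv_lhs => rw [← h2, h]
      ring
    omega
  · have h5 : (u + 1) / 2 = u / 2 + 1 := by omega
    have h4 : C.m * u = u / 2 * C.m + (u / 2 + 1) * C.m := by
      conv_lhs => rw [← h2, show u % 2 = 1 by omega]
      ring
    rw [h5]
    omega

theorem lb1_add_lb2 {l : ℕ} (hl : 1 ≤ l) : C.lb1 l + C.lb2 l = l := by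
  obtain ⟨w, v, -, h, -⟩ := C.lb_cases hl
  exact h

theorem le_lb1_of_lt_lb2 {l : ℕ} (hl : 1 ≤ l) {y : ℕ} (h : y * C.m < C.lb2 l) :
    (y + 1) * C.m ≤ C.lb1 l := by
  obtain ⟨w, v, hv, -, ⟨h1, h2⟩ | ⟨h1, h2⟩⟩ := C.lb_cases hl
  · have h3 : y < w := lt_of_mul_lt_mul_right (h2 ▸ h) (Nat.zero_le C.m)
    have h4 : (y + 1) * C.m ≤ w * C.m := Nat.mul_le_mul_right _ h3
    omega
  · have h3 : y < w + 1 := by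
      refine lt_of_mul_lt_mul_right (a := C.m) ?_ (Nat.zero_le _)
      rw [add_mul, one_mul]
      omega
    rw [h1]
    exact Nat.mul_le_mul_right _ h3

theorem le_lb2_of_lt_lb1 {l : ℕ} (hl : 1 ≤ l) {y : ℕ} (h : (y + 1) * C.m < C.lb1 l) :
    (y + 1) * C.m ≤ C.lb2 l := by
  obtain ⟨w, v, hv, -, ⟨h1, h2⟩ | ⟨h1, h2⟩⟩ := C.lb_cases hl
  · have h3 : y + 1 < w + 1 := by
      refine lt_of_mul_lt_mul_right (a := C.m) ?_ (Nat.zero_le _)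
      rw [add_mul w, one_mul]
      omega
    rw [h2]
    exact Nat.mul_le_mul_right _ (by omega)
  · have h3 : y + 1 < w + 1 := lt_of_mul_lt_mul_right (h1 ▸ h) (Nat.zero_le C.m)
    have h4 : (y + 1) * C.m ≤ w * C.m := Nat.mul_le_mul_right _ (by omega)
    omega

/-- The columns of the matrix defining `B_l`. -/
def bcol (l : ℕ) (t : Fin l) : Bool × ℕ :=
  if (t : ℕ) < C.lb1 l then (true, t) else (false, t - C.lb1 l)

theorem bcol_injective (l : ℕ) : Function.Injective (C.bcol l) := by
  intro s t h
  unfold bcol at h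
  split_ifs at h <;> simp only [Prod.mk.injEq, reduceCtorEq, false_and, true_and] at h <;>
    exact Fin.ext (by omega)

theorem true_mem_range_bcol {l : ℕ} (hl : 1 ≤ l) (x : ℕ) :
    (true, x) ∈ Set.range (C.bcol l) ↔ x < C.lb1 l := by
  have h1 := C.lb1_add_lb2 hl
  constructor
  · rintro ⟨t, ht⟩
    unfold bcol at ht
    split_ifs at ht with h <;> simp at ht
    omega
  · intro h
    exact ⟨⟨x, by omega⟩, by simp [bcol, h]⟩

theorem false_mem_range_bcol {l : ℕ} (hl : 1 ≤ l) (x : ℕ) :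
    (false, x) ∈ Set.range (C.bcol l) ↔ x < C.lb2 l := by
  have h1 := C.lb1_add_lb2 hl
  constructor
  · rintro ⟨t, ht⟩
    unfold bcol at ht
    split_ifs at ht with h <;> simp at ht
    omega
  · intro h
    exact ⟨⟨C.lb1 l + x, by omega⟩, by simp [bcol]⟩

/-- The determinant `B_l` as a polynomial in the creation operators. -/
def bpoly (l : ℕ) : FPoly C.n :=
  if h : l ≤ C.n then (colMat h (C.bcol l)).det else 0

theorem bpoly_of_le {l : ℕ} (h : l ≤ C.n) : C.bpoly l = (colMat h (C.bcol l)).det := dif_pos h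

theorem Bdet_eq {l : ℕ} (h : l ≤ C.n) : C.Bdet l = C.creatorHom (C.bpoly l) := by
  rw [bpoly_of_le C h, Matrix.det_apply, map_sum, Bdet, ncdet]
  refine Finset.sum_congr rfl fun σ _ => ?_
  rw [Units.smul_def, map_zsmul, Fin.prod_univ_def, map_list_prod, List.map_map]
  congr 2
  refine List.map_congr_left fun t _ => ?_
  rw [Function.comp_apply, colMat, Matrix.of_apply, creatorHom_X, Bentry, bcol]
  by_cases ht : (t : ℕ) < C.lb1 l
  · rw [if_pos ht, if_pos (Nat.succ_le_of_lt ht), creator_true, Fin.val_castLE]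
  · rw [if_neg ht, if_neg (by omega), creator_false, Fin.val_rev, Fin.val_castLE]
    have := (σ t).2
    congr 1 <;> omega

/-- Exponent of `B_{idx + 1}` in `v_ν`. -/
def expo (ν : ℕ → ℤ) (idx : ℕ) : ℕ := (ν (idx + 1) - ν (idx + 2)).toNat

/-- The polynomial representing `v_ν`. -/
def vpoly (ν : ℕ → ℤ) : FPoly C.n :=
  ∏ idx ∈ Finset.range C.n, C.bpoly (idx + 1) ^ expo ν idx

theorem vB_eq (ν : ℕ → ℤ) : C.vB ν = C.fock (C.vpoly ν) := by
  rw [fock_apply, vpoly, vB, Finset.prod_range, Fin.prod_univ_def, map_list_prod,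
    List.map_map, ← List.map_coe_finRange_eq_range, List.map_map]
  congr 2
  refine List.map_congr_left fun i _ => ?_
  rw [Function.comp_apply, Function.comp_apply, map_pow, ← Bdet_eq C (by omega), expo]

theorem vpoly_ne_zero (ν : ℕ → ℤ) : C.vpoly ν ≠ 0 := by
  refine Finset.prod_ne_zero_iff.2 fun idx h => pow_ne_zero _ ?_
  rw [bpoly_of_le C (Finset.mem_range.1 h)]
  exact colMat_det_ne_zero _ (C.bcol_injective _)

theorem colRepl_vpoly_eq_zero (ν : ℕ → ℤ) {y z : Bool × ℕ} (hyz : y ≠ z)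
    (h : ∀ l, 1 ≤ l → y ∈ Set.range (C.bcol l) → z ∈ Set.range (C.bcol l)) :
    colRepl y z (C.vpoly ν) = 0 := by
  rw [vpoly, derivation_prod_pow_eigen _ _ _ _ (fun _ => 0)]
  · simp
  · intro idx hidx _
    rw [zero_smul, bpoly_of_le C (Finset.mem_range.1 hidx)]
    exact colRepl_det_eq_zero _ _ hyz (h _ (by omega))

theorem pderiv_prod_eq_zero (ν : ℕ → ℤ) (s : Finset ℕ) (hs : ∀ idx ∈ s, idx < C.n) {a : ℕ}
    (h : ∀ idx ∈ s, expo ν idx ≠ 0 → idx + 1 ≤ a) (y : Bool × ℕ) (c : Fin C.n) (hc : a ≤ c) :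
    pderiv (y, c) (∏ idx ∈ s, C.bpoly (idx + 1) ^ expo ν idx) = 0 := by
  rw [derivation_prod_pow_eigen _ _ _ _ (fun _ => 0)]
  · simp
  · intro idx hidx he
    rw [zero_smul, bpoly_of_le C (hs idx hidx)]
    exact pderiv_det_of_row _ _ _ ((h idx hidx he).trans hc)

theorem contract_vpoly_eq_zero (ν : ℕ → ℤ) {d : ℕ} (hd : 2 * d ≤ C.n)
    (h : (∀ idx < C.n, expo ν idx ≠ 0 → idx + 1 ≤ d) ∨
      (d < C.n - d ∧ expo ν (C.n - d - 1) = 1 ∧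
        ∀ idx < C.n, idx ≠ C.n - d - 1 → expo ν idx ≠ 0 → idx + 1 ≤ d)) (y z : Bool × ℕ) :
    contract y z (C.vpoly ν) = 0 := by
  rcases h with h | ⟨h1, h2, h3⟩
  · rw [← mul_one (C.vpoly ν)]
    refine contract_mul (a := d) (b := 0) (by omega) (by omega) ?_ ?_ _ _ ?_
    · exact fun y c hc => C.pderiv_prod_eq_zero ν _ (by simp) (by simpa using h) y c hc
    · simp
    · simp [contract]
  · have hmem : C.n - d - 1 ∈ Finset.range C.n := Finset.mem_range.2 (by omega)
    have hl : C.n - d - 1 + 1 ≤ C.n := by omega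
    rw [vpoly, ← Finset.prod_erase_mul _ _ hmem, h2, pow_one]
    refine contract_mul (a := d) (b := C.n - d) (by omega) (by omega) ?_ ?_ _ _ ?_
    · refine fun y c hc => C.pderiv_prod_eq_zero ν _ ?_ ?_ y c hc
      · exact fun idx hidx => Finset.mem_range.1 (Finset.mem_of_mem_erase hidx)
      · exact fun idx hidx => h3 idx (Finset.mem_range.1 (Finset.mem_of_mem_erase hidx))
          (Finset.ne_of_mem_erase hidx)
    · intro y c hc
      rw [bpoly_of_le C hl]
      exact pderiv_det_of_row _ _ _ (by omega)
    · rw [bpoly_of_le C hl]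
      exact contract_det _ (C.bcol_injective _) _ _

theorem sum_fin_rev {n : ℕ} {M : Type*} [AddCommMonoid M] (f : Fin n → M) :
    ∑ c, f (Fin.rev c) = ∑ c, f c :=
  Equiv.sum_comp Fin.revPerm f

theorem nord_of_commute {u v : C.W} (h : u * v = v * u) (l : ℤ) : C.nord u l v = u * v := by
  unfold nord
  rw [← h]
  split_ifs
  · rfl
  · rw [← two_smul ℂ, smul_smul]
    norm_num
  · rfl

theorem sum_PhiW_PhibarW_smul_vB {ν : ℕ → ℤ} (hν : ∀ y z, contract y z (C.vpoly ν) = 0)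
    {s t : ℤ} (hst : 0 ≤ s + t) :
    (∑ c : Fin C.n, C.PhiW (c + 1) s * C.PhibarW (c + 1) t) • C.vB ν = 0 := by
  rw [vB_eq, Finset.sum_smul]
  rcases lt_or_ge t 0 with ht | ht
  · have h1 : ∀ c : Fin C.n, (C.PhiW (c + 1) s * C.PhibarW (c + 1) t) • C.fock (C.vpoly ν)
        = -C.fock (X ((false, (-t - 1).toNat), Fin.rev c) *
          pderiv ((false, s.toNat), Fin.rev c) (C.vpoly ν)) := fun c => by
      rw [← C.PhibarW_commute_PhiW _ _ _ _ (by omega), mul_smul,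
        C.PhiW_nonneg_smul_fock c (by omega), smul_neg, C.PhibarW_neg_smul_fock c ht]
    rw [Finset.sum_congr rfl fun c _ => h1 c, Finset.sum_neg_distrib, ← map_sum,
      sum_fin_rev fun c => X ((false, (-t - 1).toNat), c) *
          pderiv ((false, s.toNat), c) (C.vpoly ν), ← colRepl_apply,
      colRepl_vpoly_eq_zero, map_zero, neg_zero]
    · simp
      omega
    · intro l hl
      rw [false_mem_range_bcol C hl, false_mem_range_bcol C hl]
      omega
  rcases lt_or_ge s 0 with hs | hs
  · have h1 : ∀ c : Fin C.n, (C.PhiW (c + 1) s * C.PhibarW (c + 1) t) • C.fock (C.vpoly ν)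
        = C.fock (X ((true, (-s - 1).toNat), c) *
          pderiv ((true, t.toNat), c) (C.vpoly ν)) := fun c => by
      rw [mul_smul, C.PhibarW_nonneg_smul_fock c ht, C.PhiW_neg_smul_fock c hs]
    rw [Finset.sum_congr rfl fun c _ => h1 c, ← map_sum, ← colRepl_apply,
      colRepl_vpoly_eq_zero, map_zero]
    · simp
      omega
    · intro l hl
      rw [true_mem_range_bcol C hl, true_mem_range_bcol C hl]
      omega
  · have h1 : ∀ c : Fin C.n, (C.PhiW (c + 1) s * C.PhibarW (c + 1) t) • C.fock (C.vpoly ν)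
        = -C.fock (pderiv ((true, t.toNat), c)
          (pderiv ((false, s.toNat), Fin.rev c) (C.vpoly ν))) := fun c => by
      rw [mul_smul, C.PhibarW_nonneg_smul_fock c ht, C.PhiW_nonneg_smul_fock c hs,
        pderiv_pderiv_comm]
    rw [Finset.sum_congr rfl fun c _ => h1 c, Finset.sum_neg_distrib, ← map_sum]
    exact (congrArg (fun p => -C.fock p) (hν (true, t.toNat) (false, s.toNat))).trans (by simp)

theorem sum_PhiW_PhiW_smul_vB_of_nonneg {ν : ℕ → ℤ} (hν : ∀ y z, contract y z (C.vpoly ν) = 0)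
    {s t : ℤ} (ht : 0 ≤ t)
    (h : s < 0 → ∀ l, 1 ≤ l → t.toNat < C.lb2 l → (-s - 1).toNat < C.lb1 l) :
    (∑ c : Fin C.n, C.PhiW (c + 1) s * C.PhiW (Fin.rev c + 1) t) • C.vB ν = 0 := by
  rw [vB_eq, Finset.sum_smul]
  rcases lt_or_ge s 0 with hs | hs
  · have h1 : ∀ c : Fin C.n, (C.PhiW (c + 1) s * C.PhiW (Fin.rev c + 1) t) • C.fock (C.vpoly ν)
        = -C.fock (X ((true, (-s - 1).toNat), c) *
          pderiv ((false, t.toNat), c) (C.vpoly ν)) := fun c => by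
      rw [mul_smul, C.PhiW_nonneg_smul_fock _ ht, smul_neg, C.PhiW_neg_smul_fock c hs,
        Fin.rev_rev]
    rw [Finset.sum_congr rfl fun c _ => h1 c, Finset.sum_neg_distrib, ← map_sum, ← colRepl_apply,
      colRepl_vpoly_eq_zero, map_zero, neg_zero]
    · simp
    · intro l hl
      rw [false_mem_range_bcol C hl, true_mem_range_bcol C hl]
      exact h hs l hl
  · have h1 : ∀ c : Fin C.n, (C.PhiW (c + 1) s * C.PhiW (Fin.rev c + 1) t) • C.fock (C.vpoly ν)
        = C.fock (pderiv ((false, t.toNat), c)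
          (pderiv ((false, s.toNat), Fin.rev c) (C.vpoly ν))) := fun c => by
      rw [mul_smul, C.PhiW_nonneg_smul_fock _ ht, smul_neg, C.PhiW_nonneg_smul_fock c hs,
        pderiv_pderiv_comm, Fin.rev_rev, neg_neg]
    rw [Finset.sum_congr rfl fun c _ => h1 c, ← map_sum]
    exact (congrArg C.fock (hν (false, t.toNat) (false, s.toNat))).trans (map_zero _)

theorem sum_PhiW_PhiW_comm (s t : ℤ) :
    ∑ c : Fin C.n, C.PhiW (c + 1) s * C.PhiW (Fin.rev c + 1) t
      = ∑ c : Fin C.n, C.PhiW (c + 1) t * C.PhiW (Fin.rev c + 1) s := by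
  rw [← Equiv.sum_comp Fin.revPerm]
  refine Finset.sum_congr rfl fun c _ => ?_
  rw [Fin.revPerm_apply, Fin.rev_rev, PhiW_mul_PhiW]

theorem sum_PhibarW_PhibarW_smul_vB_of_nonneg {ν : ℕ → ℤ}
    (hν : ∀ y z, contract y z (C.vpoly ν) = 0) {s t : ℤ} (ht : 0 ≤ t)
    (h : s < 0 → ∀ l, 1 ≤ l → t.toNat < C.lb1 l → (-s - 1).toNat < C.lb2 l) :
    (∑ c : Fin C.n, C.PhibarW (c + 1) s * C.PhibarW (Fin.rev c + 1) t) • C.vB ν = 0 := by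
  rw [vB_eq, Finset.sum_smul]
  rcases lt_or_ge s 0 with hs | hs
  · have h1 : ∀ c : Fin C.n,
        (C.PhibarW (c + 1) s * C.PhibarW (Fin.rev c + 1) t) • C.fock (C.vpoly ν)
        = C.fock (X ((false, (-s - 1).toNat), Fin.rev c) *
          pderiv ((true, t.toNat), Fin.rev c) (C.vpoly ν)) := fun c => by
      rw [mul_smul, C.PhibarW_nonneg_smul_fock _ ht, C.PhibarW_neg_smul_fock c hs]
    rw [Finset.sum_congr rfl fun c _ => h1 c, ← map_sum,
      sum_fin_rev fun c => X ((false, (-s - 1).toNat), c) *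
          pderiv ((true, t.toNat), c) (C.vpoly ν), ← colRepl_apply,
      colRepl_vpoly_eq_zero, map_zero]
    · simp
    · intro l hl
      rw [false_mem_range_bcol C hl, true_mem_range_bcol C hl]
      exact h hs l hl
  · have h1 : ∀ c : Fin C.n,
        (C.PhibarW (c + 1) s * C.PhibarW (Fin.rev c + 1) t) • C.fock (C.vpoly ν)
        = C.fock (pderiv ((true, s.toNat), c)
          (pderiv ((true, t.toNat), Fin.rev c) (C.vpoly ν))) := fun c => by
      rw [mul_smul, C.PhibarW_nonneg_smul_fock _ ht, C.PhibarW_nonneg_smul_fock c hs]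
    rw [Finset.sum_congr rfl fun c _ => h1 c, ← map_sum]
    exact (congrArg C.fock (hν (true, s.toNat) (true, t.toNat))).trans (map_zero _)

theorem sum_PhibarW_PhibarW_comm (s t : ℤ) :
    ∑ c : Fin C.n, C.PhibarW (c + 1) s * C.PhibarW (Fin.rev c + 1) t
      = ∑ c : Fin C.n, C.PhibarW (c + 1) t * C.PhibarW (Fin.rev c + 1) s := by
  rw [← Equiv.sum_comp Fin.revPerm]
  refine Finset.sum_congr rfl fun c _ => ?_
  rw [Fin.revPerm_apply, Fin.rev_rev, PhibarW_mul_PhibarW]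

theorem lb1_of_lb2 {l : ℕ} (hl : 1 ≤ l) {i j K A : ℤ} (hi : i ≤ C.m) (hj : j ≤ C.m)
    (hK : 0 ≤ K * C.m - j) (hj0 : 1 ≤ j) (hA : 1 ≤ A)
    (h : (K * C.m - j).toNat < C.lb2 l) (hneg : A * C.m - K * C.m - i < 0) :
    (-(A * C.m - K * C.m - i) - 1).toNat < C.lb1 l := by
  have hm := C.m_pos
  obtain ⟨y, rfl⟩ : ∃ y : ℕ, K = y + 1 := ⟨(K - 1).toNat, by
    have : 1 ≤ K := by
      by_contra hK'
      nlinarith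
    omega⟩
  have h1 : y * C.m < C.lb2 l := by
    zify
    have : ((y : ℤ) + 1) * C.m - j < C.lb2 l := by omega
    linarith
  have h2 : (((y + 1) * C.m : ℕ) : ℤ) ≤ C.lb1 l := by exact_mod_cast C.le_lb1_of_lt_lb2 hl h1
  push_cast at h2
  have h3 : 1 * (C.m : ℤ) ≤ A * C.m := mul_le_mul_of_nonneg_right hA hm.le
  omega

theorem lb2_of_lb1 {l : ℕ} (hl : 1 ≤ l) {i j k A : ℤ} (hi : 1 ≤ i)
    (hk : 0 ≤ k * C.m + j - 1) (hj : 1 ≤ j) (hA : 0 ≤ A)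
    (h : (k * C.m + j - 1).toNat < C.lb1 l) (hneg : A * C.m - k * C.m + i - 1 < 0) :
    (-(A * C.m - k * C.m + i - 1) - 1).toNat < C.lb2 l := by
  have hm := C.m_pos
  have h3 : 0 ≤ A * C.m := mul_nonneg hA hm.le
  obtain ⟨y, rfl⟩ : ∃ y : ℕ, k = y + 1 := ⟨(k - 1).toNat, by
    have : 1 ≤ k := by
      by_contra hK'
      nlinarith
    omega⟩
  have h1 : (y + 1) * C.m < C.lb1 l := by
    zify
    omega
  have h2 : (((y + 1) * C.m : ℕ) : ℤ) ≤ C.lb2 l := by exact_mod_cast C.le_lb2_of_lt_lb1 hl h1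
  push_cast at h2
  omega

theorem Top_vB_eq_zero {ν : ℕ → ℤ} (hν : ∀ y z, contract y z (C.vpoly ν) = 0) {i j : ℕ}
    (hi : 1 ≤ i) (him : i ≤ C.m) (hj : 1 ≤ j) (hjm : j ≤ C.m) {a : ℤ} (b : ℤ)
    (ha : 0 < a ∨ (a = 0 ∧ i < j)) : C.Top i j a b (C.vB ν) = 0 := by
  refine finsum_eq_zero_of_forall_eq_zero fun k => ?_
  rw [smul_assoc]
  have hst : 0 ≤ ((a - k - C.sig + C.sig) * C.m - i) + (k * C.m + j - 1) := by
    rw [show ((a - k - C.sig + C.sig) * C.m - i) + (k * C.m + j - 1) = a * C.m - i + j - 1 by ring]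
    rcases ha with ha | ⟨rfl, ha⟩
    · have : 1 * (C.m : ℤ) ≤ a * C.m := mul_le_mul_of_nonneg_right ha C.m_pos.le
      omega
    · omega
  have h : ∀ c : Fin C.n, C.nord (C.psiS i (c + 1) (a - k - C.sig)) k (C.psibarS j (c + 1) k)
      = C.PhiW (c + 1) ((a - k - C.sig + C.sig) * C.m - i)
        * C.PhibarW (c + 1) (k * C.m + j - 1) := fun c => by
    rw [C.psiS_eq hi him, C.psibarS_eq hj hjm]
    exact C.nord_of_commute (C.PhibarW_commute_PhiW _ _ _ _ (by omega)).symm k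
  rw [Finset.sum_congr rfl fun c _ => h c, C.sum_PhiW_PhibarW_smul_vB hν hst, smul_zero]

theorem psi_psi_vB_eq_zero {ν : ℕ → ℤ} (hν : ∀ y z, contract y z (C.vpoly ν) = 0) {i j : ℕ}
    (hi : 1 ≤ i) (him : i ≤ C.m) (hj : 1 ≤ j) (hjm : j ≤ C.m) {a : ℤ} (b : ℤ)
    (ha : 0 < a ∨ (a = 0 ∧ C.sig = 1)) :
    (∑ᶠ k : ℤ, (C.qp b k • ∑ c : Fin C.n,
      C.nord (C.psiS i ((c : ℕ) + 1) (a - k - C.sig)) k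
        (C.psiS j (C.n - (c : ℕ)) k)) • C.vB ν) = 0 := by
  refine finsum_eq_zero_of_forall_eq_zero fun k => ?_
  rw [smul_assoc]
  have h : ∀ c : Fin C.n, C.nord (C.psiS i (c + 1) (a - k - C.sig)) k (C.psiS j (C.n - c) k)
      = C.PhiW (c + 1) ((a + C.sig) * C.m - (k + C.sig) * C.m - i)
        * C.PhiW (Fin.rev c + 1) ((k + C.sig) * C.m - j) := fun c => by
    rw [C.psiS_eq hi him, show C.n - (c : ℕ) = Fin.rev c + 1 by rw [Fin.val_rev]; omega,
      C.psiS_eq hj hjm, C.nord_of_commute (C.PhiW_mul_PhiW _ _ _ _)]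
    congr 2
    ring
  rw [Finset.sum_congr rfl fun c _ => h c]
  have hA : 1 ≤ a + C.sig := by rcases C.hsig with h | h <;> omega
  have hA' : 1 * (C.m : ℤ) ≤ (a + C.sig) * C.m := mul_le_mul_of_nonneg_right hA C.m_pos.le
  convert smul_zero (C.qp b k)
  rcases le_or_gt 0 ((k + C.sig) * C.m - (j : ℤ)) with ht | ht
  · exact C.sum_PhiW_PhiW_smul_vB_of_nonneg hν ht fun hs l hl hlt =>
      C.lb1_of_lb2 hl (by omega) (by omega) ht (by omega) hA hlt hs
  · rw [sum_PhiW_PhiW_comm]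
    have hs : 0 ≤ (a + C.sig) * C.m - (k + C.sig) * C.m - (i : ℤ) := by
      have : k + C.sig ≤ 0 := by
        by_contra hk
        nlinarith [C.m_pos]
      nlinarith [C.m_pos]
    refine C.sum_PhiW_PhiW_smul_vB_of_nonneg hν hs fun _ l hl hlt => ?_
    have := C.lb1_of_lb2 (K := a - k) (i := j) (j := i) (A := a + C.sig) hl (by omega) (by omega)
      (by linarith) (by omega) hA (by convert hlt using 2; ring) (by linarith)
    convert this using 4
    ring

theorem psibar_psibar_vB_eq_zero {ν : ℕ → ℤ} (hν : ∀ y z, contract y z (C.vpoly ν) = 0) {i j : ℕ}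
    (hi : 1 ≤ i) (him : i ≤ C.m) (hj : 1 ≤ j) (hjm : j ≤ C.m) {a : ℤ} (b : ℤ)
    (ha : 0 < a ∨ (a = 0 ∧ C.sig = 0)) :
    (∑ᶠ k : ℤ, (C.qp b k • ∑ c : Fin C.n,
      C.nord (C.psibarS i ((c : ℕ) + 1) (a - k - C.sig)) k
        (C.psibarS j (C.n - (c : ℕ)) k)) • C.vB ν) = 0 := by
  refine finsum_eq_zero_of_forall_eq_zero fun k => ?_
  rw [smul_assoc]
  have h : ∀ c : Fin C.n,
      C.nord (C.psibarS i (c + 1) (a - k - C.sig)) k (C.psibarS j (C.n - c) k)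
      = C.PhibarW (c + 1) ((a - C.sig) * C.m - k * C.m + i - 1)
        * C.PhibarW (Fin.rev c + 1) (k * C.m + j - 1) := fun c => by
    rw [C.psibarS_eq hi him, show C.n - (c : ℕ) = Fin.rev c + 1 by rw [Fin.val_rev]; omega,
      C.psibarS_eq hj hjm, C.nord_of_commute (C.PhibarW_mul_PhibarW _ _ _ _)]
    congr 2
    ring
  rw [Finset.sum_congr rfl fun c _ => h c]
  have hA : 0 ≤ a - C.sig := by rcases C.hsig with h | h <;> omega
  have hA' : 0 ≤ (a - C.sig) * C.m := mul_nonneg hA C.m_pos.le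
  convert smul_zero (C.qp b k)
  rcases le_or_gt 0 (k * C.m + (j : ℤ) - 1) with ht | ht
  · exact C.sum_PhibarW_PhibarW_smul_vB_of_nonneg hν ht fun hs l hl hlt =>
      C.lb2_of_lb1 hl (by omega) ht (by omega) hA hlt hs
  · rw [sum_PhibarW_PhibarW_comm]
    have hs : 0 ≤ (a - C.sig) * C.m - k * C.m + (i : ℤ) - 1 := by
      have : k < 0 := by
        by_contra hk
        nlinarith [C.m_pos]
      nlinarith [C.m_pos]
    refine C.sum_PhibarW_PhibarW_smul_vB_of_nonneg hν hs fun _ l hl hlt => ?_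
    have := C.lb2_of_lb1 (k := a - C.sig - k) (i := j) (j := i) (A := a - C.sig) hl (by omega)
      (by linarith) (by omega) hA (by convert hlt using 2; ring) (by linarith)
    convert this using 4
    ring

/-- The column index paired with `ψ_i(-r)` and `ψ̄_i(r)`, where `k` encodes `r`. -/
def pos (k : ℤ) (i : ℕ) : Bool × ℕ :=
  if 0 ≤ k then (true, (k * C.m + i - 1).toNat) else (false, (-(k * C.m) - i).toNat)

theorem pos_of_nonneg {k : ℤ} (hk : 0 ≤ k) (i : ℕ) :
    C.pos k i = (true, (k * C.m + i - 1).toNat) := if_pos hk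

theorem pos_of_neg {k : ℤ} (hk : k < 0) (i : ℕ) :
    C.pos k i = (false, (-(k * C.m) - i).toNat) := if_neg (by omega)

theorem mul_m_nonneg {k : ℤ} (hk : 0 ≤ k) : 0 ≤ k * (C.m : ℤ) := mul_nonneg hk C.m_pos.le

theorem mul_m_le_neg {k : ℤ} (hk : k < 0) : k * (C.m : ℤ) ≤ -C.m := by
  have : k * (C.m : ℤ) ≤ (-1) * C.m := mul_le_mul_of_nonneg_right (by omega) C.m_pos.le
  omega

theorem nord_smul_fock {i : ℕ} (hi : 1 ≤ i) (him : i ≤ C.m) (c c' : Fin C.n) (k : ℤ)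
    (p : FPoly C.n) :
    C.nord (C.psiS i (c + 1) (-k - C.sig)) k (C.psibarS i (c' + 1) k) • C.fock p
      = (if 0 ≤ k then C.fock (X (C.pos k i, c) * pderiv (C.pos k i, c') p)
          else -C.fock (X (C.pos k i, Fin.rev c') * pderiv (C.pos k i, Fin.rev c) p))
        + if c = c' ∧ 2 * k + C.sig = 0 then (2 : ℂ)⁻¹ • C.fock p else 0 := by
  rw [C.psiS_eq hi him, C.psibarS_eq hi him]
  have hcomm := C.PhibarW_mul_PhiW c' c (k * C.m + i - 1) ((-k - C.sig + C.sig) * C.m - i)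
  rcases le_or_gt 0 k with hk | hk
  · have hkm := C.mul_m_nonneg hk
    have h1 : (C.PhiW (c + 1) ((-k - C.sig + C.sig) * C.m - i)
        * C.PhibarW (c' + 1) (k * C.m + i - 1)) • C.fock p
        = C.fock (X (C.pos k i, c) * pderiv (C.pos k i, c') p) := by
      have hs : (-k - C.sig + C.sig) * C.m - (i : ℤ) = -(k * C.m + i - 1) - 1 := by ring
      rw [hs, mul_smul, C.PhibarW_nonneg_smul_fock c' (by omega),
        C.PhiW_neg_smul_fock c (by omega), pos_of_nonneg C hk]
      congr 5
      omega
    rw [if_pos hk, ← h1]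
    have hsig := C.hsig
    unfold nord
    rcases (show 0 ≤ 2 * k + C.sig by omega).eq_or_lt with h0 | h0
    · rw [if_neg (by omega), if_pos h0.symm, hcomm]
      simp only [← h0, and_true, show (-k - C.sig + C.sig) * (C.m : ℤ) - i + (k * C.m + i - 1) = -1
        by ring, @eq_comm _ c' c]
      rw [← add_assoc, ← two_smul ℂ, smul_add, smul_smul, inv_mul_cancel₀ two_ne_zero, one_smul,
        add_smul]
      congr 1
      split_ifs
      · rw [smul_assoc, one_smul]
      · rw [smul_zero, zero_smul]
    · rw [if_pos h0, if_neg (by omega), add_zero]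
  · have hkm := C.mul_m_le_neg hk
    have hsig := C.hsig
    have hs : (-k - C.sig + C.sig) * C.m - (i : ℤ) = -(k * C.m) - i := by ring
    unfold nord
    rw [if_neg (by omega), if_neg (by omega), if_neg (by omega), if_neg (by omega), add_zero, hs,
      mul_smul, C.PhiW_nonneg_smul_fock c (by omega), smul_neg,
      C.PhibarW_neg_smul_fock c' (by omega), pos_of_neg C hk]
    congr 6
    omega

/-- Sum of the multiplicities of the `B_l` in `v_ν` whose matrix contains the column `y`. -/
def colWeight (ν : ℕ → ℤ) (y : Bool × ℕ) : ℂ :=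
  ∑ idx ∈ Finset.range C.n,
    (expo ν idx : ℂ) * if y ∈ Set.range (C.bcol (idx + 1)) then 1 else 0

theorem colRepl_self_vpoly (ν : ℕ → ℤ) (y : Bool × ℕ) :
    colRepl y y (C.vpoly ν) = C.colWeight ν y • C.vpoly ν := by
  refine derivation_prod_pow_eigen _ _ _ _ _ fun idx hidx _ => ?_
  rw [bpoly_of_le C (Finset.mem_range.1 hidx), colRepl_self_det _ (C.bcol_injective _)]

theorem pderiv_vpoly_of_notMem (ν : ℕ → ℤ) {y : Bool × ℕ}
    (hy : ∀ l, 1 ≤ l → l ≤ C.n → y ∉ Set.range (C.bcol l)) (c : Fin C.n) :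
    pderiv (y, c) (C.vpoly ν) = 0 := by
  rw [vpoly, derivation_prod_pow_eigen _ _ _ _ (fun _ => 0)]
  · simp
  · intro idx hidx _
    have hl := Finset.mem_range.1 hidx
    rw [zero_smul, bpoly_of_le C hl]
    exact pderiv_det_of_notMem _ (hy _ (by omega) hl) _

theorem pos_mem_range_bcol {l : ℕ} (hl : 1 ≤ l) {k : ℤ} {i : ℕ} (hi : 1 ≤ i) (him : i ≤ C.m) :
    C.pos k i ∈ Set.range (C.bcol l) ↔
      (0 ≤ k ∧ 1 ≤ k * (C.m : ℤ) + i ∧ k * (C.m : ℤ) + i ≤ C.lb1 l) ∨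
      (k < 0 ∧ 1 ≤ -(k * (C.m : ℤ)) - i + 1 ∧ -(k * (C.m : ℤ)) - i + 1 ≤ C.lb2 l) := by
  rcases le_or_gt 0 k with hk | hk
  · have hkm := C.mul_m_nonneg hk
    rw [pos_of_nonneg C hk, true_mem_range_bcol C hl]
    omega
  · have hkm := C.mul_m_le_neg hk
    rw [pos_of_neg C hk, false_mem_range_bcol C hl]
    omega

theorem mem_Icc_of_pos_mem {l : ℕ} (hl : 1 ≤ l) (hln : l ≤ C.n) {k : ℤ} {i : ℕ} (hi : 1 ≤ i)
    (him : i ≤ C.m) (h : C.pos k i ∈ Set.range (C.bcol l)) :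
    k ∈ Finset.Icc (-(C.n : ℤ)) C.n := by
  have h1 := C.lb1_add_lb2 hl
  have h2 := C.m_pos
  rw [Finset.mem_Icc]
  rcases (C.pos_mem_range_bcol hl hi him).1 h with ⟨h3, h4, h5⟩ | ⟨h3, h4, h5⟩
  · constructor <;> nlinarith
  · constructor <;> nlinarith

/-- All column indices which occur in the matrices defining `B_1, …, B_n`. -/
def positions : Finset (Bool × ℕ) :=
  (Finset.Icc (-(C.n : ℤ)) C.n ×ˢ (Finset.univ : Finset (Fin C.m))).image
    fun x => C.pos x.1 (x.2 + 1)

theorem bcol_mem_positions {l : ℕ} (hl : l ≤ C.n) (t : Fin l) : C.bcol l t ∈ C.positions := by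
  have ht := t.2
  have key : ∀ x < C.n, (true, x) ∈ C.positions ∧ (false, x) ∈ C.positions := by
    intro x hx
    obtain ⟨u, r, hr, rfl⟩ : ∃ u r, r < C.m ∧ x = C.m * u + r :=
      ⟨x / C.m, x % C.m, Nat.mod_lt x C.hm, (Nat.div_add_mod x C.m).symm⟩
    have h3 : u ≤ C.m * u := Nat.le_mul_of_pos_left u C.hm
    have h4 : ((C.m * u : ℕ) : ℤ) = u * C.m := by
      push_cast
      ring
    constructor
    · refine Finset.mem_image.2 ⟨(u, ⟨r, hr⟩), ?_, ?_⟩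
      · simp only [Finset.mem_product, Finset.mem_Icc, Finset.mem_univ, and_true]
        omega
      · rw [pos_of_nonneg C (by positivity), ← h4]
        congr 1
        dsimp only
        omega
    · refine Finset.mem_image.2 ⟨(-(u : ℤ) - 1, ⟨C.m - 1 - r, by omega⟩), ?_, ?_⟩
      · simp only [Finset.mem_product, Finset.mem_Icc, Finset.mem_univ, and_true]
        omega
      · have h5 : (-(u : ℤ) - 1) * C.m = -((C.m * u : ℕ) : ℤ) - C.m := by
          rw [h4]
          ring
        rw [pos_of_neg C (by omega), h5]
        congr 1
        dsimp only
        omega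
  unfold bcol
  split_ifs
  · exact (key _ (by omega)).1
  · exact (key _ (by omega)).2

theorem pos_injective : Function.Injective fun x : ℤ × Fin C.m => C.pos x.1 (x.2 + 1) := by
  rintro ⟨k, i⟩ ⟨k', i'⟩ h
  have hm := C.m_pos
  have hi : ((i : ℕ) : ℤ) < C.m := by exact_mod_cast i.2
  have hi' : ((i' : ℕ) : ℤ) < C.m := by exact_mod_cast i'.2
  have key : k * C.m + i = k' * C.m + i' := by
    dsimp only at h
    rcases le_or_gt 0 k with hk | hk <;> rcases le_or_gt 0 k' with hk' | hk'
    · have h1 := C.mul_m_nonneg hk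
      have h2 := C.mul_m_nonneg hk'
      rw [pos_of_nonneg C hk, pos_of_nonneg C hk'] at h
      simp only [Prod.mk.injEq, true_and] at h
      omega
    · rw [pos_of_nonneg C hk, pos_of_neg C hk'] at h
      simp at h
    · rw [pos_of_nonneg C hk', pos_of_neg C hk] at h
      simp at h
    · have h1 := C.mul_m_le_neg hk
      have h2 := C.mul_m_le_neg hk'
      rw [pos_of_neg C hk, pos_of_neg C hk'] at h
      simp only [Prod.mk.injEq, true_and] at h
      omega
  have hk : k = k' := by
    rcases lt_trichotomy k k' with h1 | h1 | h1
    · nlinarith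
    · exact h1
    · nlinarith
  subst hk
  exact Prod.ext rfl (Fin.ext (by exact_mod_cast add_left_cancel key))

theorem rowRepl_vpoly (ν : ℕ → ℤ) (p : Fin C.n) :
    rowRepl C.positions p p (C.vpoly ν)
      = (∑ idx ∈ Finset.range C.n, (expo ν idx : ℂ) * if (p : ℕ) < idx + 1 then 1 else 0)
        • C.vpoly ν := by
  refine derivation_prod_pow_eigen _ _ _ _ _ fun idx hidx _ => ?_
  have hl : idx + 1 ≤ C.n := Finset.mem_range.1 hidx
  rw [bpoly_of_le C hl, rowRepl_self_det _ _ (C.bcol_mem_positions hl)]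

theorem rowRepl_vpoly_eq_zero (ν : ℕ → ℤ) {p q : Fin C.n} (hpq : p < q) :
    rowRepl C.positions p q (C.vpoly ν) = 0 := by
  rw [vpoly, derivation_prod_pow_eigen _ _ _ _ (fun _ => 0)]
  · simp
  · intro idx hidx _
    have hl : idx + 1 ≤ C.n := Finset.mem_range.1 hidx
    rw [zero_smul, bpoly_of_le C hl, rowRepl_det_eq_zero _ _ (C.bcol_mem_positions hl) hpq]

theorem nord_sub_nord_smul_fock {i : ℕ} (hi : 1 ≤ i) (him : i ≤ C.m) (p q : Fin C.n) (k : ℤ)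
    (f : FPoly C.n) :
    (C.nord (C.psiS i (p + 1) (-k - C.sig)) k (C.psibarS i (q + 1) k)
      - C.nord (C.psiS i (Fin.rev q + 1) (-k - C.sig)) k (C.psibarS i (Fin.rev p + 1) k))
        • C.fock f
      = C.fock (X (C.pos k i, p) * pderiv (C.pos k i, q) f
          - X (C.pos k i, Fin.rev q) * pderiv (C.pos k i, Fin.rev p) f) := by
  rw [sub_smul, nord_smul_fock C hi him, nord_smul_fock C hi him, map_sub]
  simp only [Fin.rev_inj, Fin.rev_rev, @eq_comm _ q p]
  split_ifs <;> abel

theorem finsum_nord_sub_nord_smul_vB (ν : ℕ → ℤ) (p q : Fin C.n) :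
    (∑ᶠ k : ℤ, (∑ c : Fin C.m,
      (C.nord (C.psiS (c + 1) (p + 1) (-k - C.sig)) k (C.psibarS (c + 1) (q + 1) k)
        - C.nord (C.psiS (c + 1) (Fin.rev q + 1) (-k - C.sig)) k
            (C.psibarS (c + 1) (Fin.rev p + 1) k))) • C.vB ν)
      = C.fock (rowRepl C.positions p q (C.vpoly ν)
          - rowRepl C.positions (Fin.rev q) (Fin.rev p) (C.vpoly ν)) := by
  set G : Bool × ℕ → FPoly C.n := fun y => X (y, p) * pderiv (y, q) (C.vpoly ν)
    - X (y, Fin.rev q) * pderiv (y, Fin.rev p) (C.vpoly ν) with hG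
  have h1 : ∀ k : ℤ, (∑ c : Fin C.m,
      (C.nord (C.psiS (c + 1) (p + 1) (-k - C.sig)) k (C.psibarS (c + 1) (q + 1) k)
        - C.nord (C.psiS (c + 1) (Fin.rev q + 1) (-k - C.sig)) k
            (C.psibarS (c + 1) (Fin.rev p + 1) k))) • C.vB ν
      = C.fock (∑ c : Fin C.m, G (C.pos k (c + 1))) := fun k => by
    rw [vB_eq, Finset.sum_smul, map_sum]
    exact Finset.sum_congr rfl fun c _ =>
      C.nord_sub_nord_smul_fock (by omega) (by omega) p q k _
  rw [finsum_congr h1, finsum_eq_sum_of_support_subset (s := Finset.Icc (-(C.n : ℤ)) C.n),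
    ← map_sum, ← Finset.sum_product', rowRepl_apply, rowRepl_apply, ← Finset.sum_sub_distrib,
    positions, Finset.sum_image C.pos_injective.injOn]
  rw [Function.support_subset_iff']
  intro k hk
  rw [Finset.sum_eq_zero, map_zero]
  intro c _
  have hnot : ∀ l, 1 ≤ l → l ≤ C.n → C.pos k (c + 1) ∉ Set.range (C.bcol l) := fun l hl hln h =>
    hk (C.mem_Icc_of_pos_mem hl hln (by omega) (by omega) h)
  simp only [hG, C.pderiv_vpoly_of_notMem ν hnot, mul_zero, sub_zero]

theorem sum_sub_mul_ite (f : ℕ → ℂ) {p n : ℕ} (hpn : p ≤ n) :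
    ∑ idx ∈ Finset.range n, (f idx - f (idx + 1)) * (if p < idx + 1 then 1 else 0)
      = f p - f n := by
  induction n, hpn using Nat.le_induction with
  | base =>
    rw [sub_self]
    refine Finset.sum_eq_zero fun idx h => ?_
    rw [if_neg (by have := Finset.mem_range.1 h; omega), mul_zero]
  | succ n hn ih =>
    rw [Finset.sum_range_succ, ih, if_pos (by omega)]
    ring

theorem expo_cast {ν : ℕ → ℤ} (hν : ∀ k, 1 ≤ k → k ≤ C.n → ν (k + 1) ≤ ν k) {idx : ℕ}
    (h : idx < C.n) : (expo ν idx : ℂ) = ν (idx + 1) - ν (idx + 1 + 1) := by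
  have h1 : ((expo ν idx : ℕ) : ℤ) = ν (idx + 1) - ν (idx + 1 + 1) :=
    Int.toNat_of_nonneg (sub_nonneg.2 (hν _ (by omega) (by omega)))
  exact_mod_cast congrArg (Int.cast : ℤ → ℂ) h1

theorem finsum_raising_smul_vB_eq_zero (ν : ℕ → ℤ) {p : ℕ} (hp : 1 ≤ p) (hpn : p + 1 ≤ C.n) :
    (∑ᶠ k : ℤ, (∑ c : Fin C.m,
      (C.nord (C.psiS ((c : ℕ) + 1) p (-k - C.sig)) k (C.psibarS ((c : ℕ) + 1) (p + 1) k)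
        - C.nord (C.psiS ((c : ℕ) + 1) (C.n - p) (-k - C.sig)) k
            (C.psibarS ((c : ℕ) + 1) (C.n + 1 - p) k))) • C.vB ν) = 0 := by
  have h := C.finsum_nord_sub_nord_smul_vB ν ⟨p - 1, by omega⟩ ⟨p, by omega⟩
  rw [rowRepl_vpoly_eq_zero C ν (Fin.mk_lt_mk.2 (by omega)),
    rowRepl_vpoly_eq_zero C ν (Fin.rev_lt_rev.2 (Fin.mk_lt_mk.2 (by omega))), sub_zero,
    map_zero] at h
  simp only [Fin.val_rev, show p - 1 + 1 = p by omega, show C.n - p + 1 = C.n + 1 - p by omega,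
    show C.n - (p + 1) + 1 = C.n - p by omega] at h
  exact h

theorem finsum_weight_smul_vB {ν : ℕ → ℤ} (hν : ∀ k, 1 ≤ k → k ≤ C.n → ν (k + 1) ≤ ν k)
    {p : ℕ} (hp : 1 ≤ p) (hpn : p ≤ C.n) :
    (∑ᶠ k : ℤ, (∑ c : Fin C.m,
      (C.nord (C.psiS ((c : ℕ) + 1) p (-k - C.sig)) k (C.psibarS ((c : ℕ) + 1) p k)
        - C.nord (C.psiS ((c : ℕ) + 1) (C.n + 1 - p) (-k - C.sig)) k
            (C.psibarS ((c : ℕ) + 1) (C.n + 1 - p) k))) • C.vB ν)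
      = ((ν p - ν (C.n + 1 - p) : ℤ) : ℂ) • C.vB ν := by
  have h := C.finsum_nord_sub_nord_smul_vB ν ⟨p - 1, by omega⟩ ⟨p - 1, by omega⟩
  have hsum : ∀ r ≤ C.n, ∑ idx ∈ Finset.range C.n, (expo ν idx : ℂ) *
      (if r < idx + 1 then 1 else 0) = ν (r + 1) - ν (C.n + 1) := fun r hr => by
    rw [← sum_sub_mul_ite (fun j => (ν (j + 1) : ℂ)) hr]
    refine Finset.sum_congr rfl fun idx hidx => ?_
    rw [C.expo_cast hν (Finset.mem_range.1 hidx)]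
  rw [rowRepl_vpoly, rowRepl_vpoly, ← sub_smul, map_smul, hsum _ (Fin.is_lt _).le,
    hsum _ (Fin.is_lt _).le, ← vB_eq] at h
  simp only [Fin.val_rev, show p - 1 + 1 = p by omega, show C.n - p + 1 = C.n + 1 - p by omega] at h
  rw [h]
  push_cast
  congr 1
  ring

theorem sum_nord_smul_vB (ν : ℕ → ℤ) {i : ℕ} (hi : 1 ≤ i) (him : i ≤ C.m) (k : ℤ) :
    (∑ c : Fin C.n, C.nord (C.psiS i (c + 1) (-k - C.sig)) k (C.psibarS i (c + 1) k)) • C.vB ν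
      = ((if 0 ≤ k then 1 else -1) * C.colWeight ν (C.pos k i)
          + if 2 * k + C.sig = 0 then (C.n : ℂ) / 2 else 0) • C.vB ν := by
  rw [vB_eq, Finset.sum_smul, Finset.sum_congr rfl fun c _ => C.nord_smul_fock hi him c c k _,
    Finset.sum_add_distrib, add_smul]
  congr 1
  · split_ifs
    · rw [one_mul, ← map_smul, ← colRepl_self_vpoly, colRepl_apply, map_sum]
    · rw [neg_one_mul, neg_smul, ← map_smul, ← colRepl_self_vpoly, colRepl_apply, map_sum,
        Finset.sum_neg_distrib, ← sum_fin_rev]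
      simp only [Fin.rev_rev]
  · simp only [true_and]
    split_ifs
    · rw [Finset.sum_const, Finset.card_univ, Fintype.card_fin, ← Nat.cast_smul_eq_nsmul ℂ,
        smul_smul, div_eq_mul_inv]
    · rw [Finset.sum_const_zero, zero_smul]

theorem Jsum_sub_Jbarsum {l : ℕ} (hl : 1 ≤ l) (hln : l ≤ C.n) {i : ℕ} (hi : 1 ≤ i)
    (him : i ≤ C.m) (b : ℤ) :
    C.Jsum i (C.lb1 l) b - C.Jbarsum i (C.lb2 l) b
      = ∑ k ∈ Finset.Icc (-(C.n : ℤ)) C.n, C.qp b k * ((if 0 ≤ k then 1 else -1) *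
          if C.pos k i ∈ Set.range (C.bcol l) then 1 else 0) := by
  have hpos := fun k : ℤ => C.pos_mem_range_bcol (k := k) hl hi him
  have hmem := fun k : ℤ => C.mem_Icc_of_pos_mem (k := k) hl hln hi him
  unfold Jsum Jbarsum
  rw [finsum_mem_def, finsum_mem_def,
    finsum_eq_sum_of_support_subset (s := Finset.Icc (-(C.n : ℤ)) C.n),
    finsum_eq_sum_of_support_subset (s := Finset.Icc (-(C.n : ℤ)) C.n), ← Finset.sum_sub_distrib]
  · refine Finset.sum_congr rfl fun k _ => ?_
    simp only [Set.indicator_apply, Set.mem_ofPred_eq, hpos]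
    rcases le_or_gt 0 k with hk | hk
    · have hkm := C.mul_m_nonneg hk
      rw [if_neg (show ¬(1 ≤ -(k * (C.m : ℤ)) - i + 1 ∧ _) by omega)]
      simp [hk, not_lt.2 hk]
    · have hkm := C.mul_m_le_neg hk
      rw [if_neg (show ¬(1 ≤ k * (C.m : ℤ) + i ∧ _) by omega)]
      simp [hk, not_le.2 hk, neg_ite]
  · rw [Function.support_subset_iff']
    intro k hk
    rw [Set.indicator_of_notMem]
    rintro ⟨h1, h2⟩
    refine hk (hmem k ((hpos k).2 (Or.inr ⟨?_, h1, h2⟩)))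
    by_contra h'
    have hkm := C.mul_m_nonneg (not_lt.1 h')
    omega
  · rw [Function.support_subset_iff']
    intro k hk
    rw [Set.indicator_of_notMem]
    rintro ⟨h1, h2⟩
    refine hk (hmem k ((hpos k).2 (Or.inl ⟨?_, h1, h2⟩)))
    by_contra h'
    have hkm := C.mul_m_le_neg (not_le.1 h')
    omega

theorem sum_qp_half (b : ℤ) :
    ∑ k ∈ Finset.Icc (-(C.n : ℤ)) C.n, C.qp b k * (if 2 * k + C.sig = 0 then (C.n : ℂ) / 2 else 0)
      = C.eps * C.n := by
  unfold eps
  rcases C.hsig with h | h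
  · rw [Finset.sum_eq_single 0]
    · simp [h, qp]
      ring
    · intro k _ hk
      rw [if_neg (by omega), mul_zero]
    · simp
  · rw [Finset.sum_eq_zero]
    · simp [h]
    · intro k _
      rw [if_neg (by omega), mul_zero]

theorem Eib_vB {ν : ℕ → ℤ} (hν : ∀ k, 1 ≤ k → k ≤ C.n → ν (k + 1) ≤ ν k) {i : ℕ} (hi : 1 ≤ i)
    (him : i ≤ C.m) (b : ℤ) : C.Eib i b (C.vB ν) = C.etaB ν i b • C.vB ν := by
  unfold Eib etaB
  have h1 : ∀ k : ℤ, (C.qp b k • ∑ c : Fin C.n,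
      C.nord (C.psiS i ((c : ℕ) + 1) (-k - C.sig)) k (C.psibarS i ((c : ℕ) + 1) k)) • C.vB ν
      = (C.qp b k * ((if 0 ≤ k then 1 else -1) * C.colWeight ν (C.pos k i))
          + C.qp b k * if 2 * k + C.sig = 0 then (C.n : ℂ) / 2 else 0) • C.vB ν := fun k => by
    rw [smul_assoc, C.sum_nord_smul_vB ν hi him, smul_smul, mul_add]
  rw [finsum_congr h1, finsum_eq_sum_of_support_subset (s := Finset.Icc (-(C.n : ℤ)) C.n),
    ← Finset.sum_smul, Finset.sum_add_distrib, sum_qp_half, ← sub_smul]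
  · congr 3
    rw [← Finset.Ico_add_one_right_eq_Icc 1 C.n, Finset.sum_Ico_eq_sum_range, Nat.add_sub_cancel]
    unfold colWeight
    simp only [Finset.mul_sum]
    rw [Finset.sum_comm]
    refine Finset.sum_congr rfl fun idx hidx => ?_
    have hidx' := Finset.mem_range.1 hidx
    rw [C.Jsum_sub_Jbarsum (by omega) (by omega) hi him, Finset.mul_sum]
    refine Finset.sum_congr rfl fun k _ => ?_
    rw [C.expo_cast hν hidx', add_comm 1 idx]
    push_cast
    ring
  · rw [Function.support_subset_iff']
    intro k hk
    have hk' : k < -(C.n : ℤ) ∨ (C.n : ℤ) < k := by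
      simp at hk
      omega
    have hsig : ¬ 2 * k + C.sig = 0 := by
      have := C.hsig
      have := C.hn
      omega
    rw [if_neg hsig, mul_zero, add_zero, colWeight, Finset.sum_eq_zero, mul_zero, mul_zero,
      zero_smul]
    intro idx hidx
    rw [if_neg, mul_zero]
    exact fun h => hk (C.mem_Icc_of_pos_mem (by omega) (Finset.mem_range.1 hidx) hi him h)

theorem pos_iff_le_card {n d : ℕ} {μ : ℕ → ℤ}
    (hdec : ∀ k : ℕ, 1 ≤ k → k < n → μ (k + 1) ≤ μ k)
    (hd : d = ((Finset.Icc 1 n).filter fun k => 0 < μ k).card) {k : ℕ} (hk : 1 ≤ k)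
    (hkn : k ≤ n) : 0 < μ k ↔ k ≤ d := by
  have hanti : ∀ j l : ℕ, 1 ≤ j → j ≤ l → l ≤ n → μ l ≤ μ j := by
    intro j l hj hjl
    induction l, hjl using Nat.le_induction with
    | base => exact fun _ => le_rfl
    | succ l hjl ih => exact fun h => (hdec l (by omega) (by omega)).trans (ih (by omega))
  constructor
  · intro h
    have hsub : Finset.Icc 1 k ⊆ (Finset.Icc 1 n).filter fun k => 0 < μ k := by
      intro j hj
      have hj' := Finset.mem_Icc.1 hj
      exact Finset.mem_filter.2 ⟨Finset.mem_Icc.2 ⟨hj'.1, by omega⟩,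
        h.trans_le (hanti j k hj'.1 hj'.2 hkn)⟩
    simpa [← hd] using Finset.card_le_card hsub
  · intro h
    by_contra h0
    have hsub : ((Finset.Icc 1 n).filter fun k => 0 < μ k) ⊆ Finset.Icc 1 (k - 1) := by
      intro j hj
      obtain ⟨hj1, hj2⟩ := Finset.mem_filter.1 hj
      have hj' := Finset.mem_Icc.1 hj1
      refine Finset.mem_Icc.2 ⟨hj'.1, ?_⟩
      by_contra hjk
      have := hanti k j hk (by omega) hj'.2
      omega
    have := Finset.card_le_card hsub
    rw [← hd, Nat.card_Icc] at this
    omega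

/-- The partition `μ̃` obtained from `μ` by replacing the length `d` of its first column
with `n - d`. -/
def flipCol (n d : ℕ) (μ : ℕ → ℤ) : ℕ → ℤ := fun kk =>
  if 1 ≤ kk ∧ kk ≤ d then μ kk else if kk ≤ n - d then 1 else 0

theorem contract_vpoly_partition {d : ℕ} {μ : ℕ → ℤ} (hdhalf : d ≤ C.n / 2)
    (hzero : ∀ k, d < k → k ≤ C.n + 1 → μ k = 0) (y z : Bool × ℕ) :
    contract y z (C.vpoly μ) = 0 := by
  refine C.contract_vpoly_eq_zero μ (d := d) (by omega) (Or.inl fun idx hidx h => ?_) y z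
  by_contra hd
  have h1 := hzero (idx + 1) (by omega) (by omega)
  have h2 := hzero (idx + 2) (by omega) (by omega)
  simp [expo, h1, h2] at h

theorem contract_vpoly_flipCol {d : ℕ} (μ : ℕ → ℤ) (hdhalf : d ≤ C.n / 2) (y z : Bool × ℕ) :
    contract y z (C.vpoly (flipCol C.n d μ)) = 0 := by
  refine C.contract_vpoly_eq_zero _ (d := d) (by omega) ?_ y z
  have hlarge : ∀ k, d < k → flipCol C.n d μ k = if k ≤ C.n - d then 1 else 0 := fun k hk =>
    if_neg (by omega)
  have hexpo : ∀ idx, d ≤ idx → idx ≠ C.n - d - 1 → expo (flipCol C.n d μ) idx = 0 := by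
    intro idx hidx hne
    rw [expo, hlarge _ (by omega), hlarge _ (by omega)]
    split_ifs <;> omega
  rcases (show d ≤ C.n - d by omega).eq_or_lt with h | h
  · refine Or.inl fun idx _ hne => ?_
    by_contra hlt
    exact hne (hexpo idx (by omega) (by omega))
  · refine Or.inr ⟨h, ?_, fun idx _ hne hexp => ?_⟩
    · rw [expo, hlarge _ (by omega), hlarge _ (by omega), if_pos (by omega), if_neg (by omega)]
      rfl
    · by_contra hlt
      exact hexp (hexpo idx (by omega) hne)

end WCtx

open WCtx in
/-- **Proposition 5.17.**  Let `μ` be a partition with at most `⌊n/2⌋` nonzero parts,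
`d` its depth, and `μ̃` the associated partition with first column replaced by `n - d`.
Then `v_{μ,S}` and `v_{μ̃,S}` are nonzero joint `(SO_n, ŝp_{2m}(C_q))`-highest weight
vectors in `F_N(S)` with highest weights `(μ, η_{μ,S})` and `(μ, η_{μ̃,S})`. -/
theorem statement19 (C : WCtx) (μ : ℕ → ℤ)
    (hdec : ∀ k : ℕ, 1 ≤ k → k < C.n → μ (k + 1) ≤ μ k)
    (hpos : 0 ≤ μ C.n) (htop : μ (C.n + 1) = 0)
    (d : ℕ) (hd : d = ((Finset.Icc 1 C.n).filter fun k => 0 < μ k).card)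
    (hdhalf : d ≤ C.n / 2) :
    ∀ ν : ℕ → ℤ,
      (ν = μ ∨ ν = fun kk => if 1 ≤ kk ∧ kk ≤ d then μ kk
        else if kk ≤ C.n - d then 1 else 0) →
      C.vB ν ≠ 0
      -- (a)
      ∧ (∀ i j : ℕ, 1 ≤ i → i ≤ C.m → 1 ≤ j → j ≤ C.m → ∀ a b : ℤ,
          (0 < a ∨ (a = 0 ∧ i < j)) → C.Top i j a b (C.vB ν) = 0)
      -- (b)
      ∧ (∀ i j : ℕ, 1 ≤ i → i ≤ C.m → 1 ≤ j → j ≤ C.m → ∀ a b : ℤ,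
          (0 < a ∨ (a = 0 ∧ C.sig = 1)) →
          (∑ᶠ k : ℤ, (C.qp b k • ∑ c : Fin C.n,
              C.nord (C.psiS i ((c : ℕ) + 1) (a - k - C.sig)) k
                (C.psiS j (C.n - (c : ℕ)) k)) • C.vB ν) = 0)
      -- (c)
      ∧ (∀ i j : ℕ, 1 ≤ i → i ≤ C.m → 1 ≤ j → j ≤ C.m → ∀ a b : ℤ,
          (0 < a ∨ (a = 0 ∧ C.sig = 0)) →
          (∑ᶠ k : ℤ, (C.qp b k • ∑ c : Fin C.n,
              C.nord (C.psibarS i ((c : ℕ) + 1) (a - k - C.sig)) k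
                (C.psibarS j (C.n - (c : ℕ)) k)) • C.vB ν) = 0)
      -- (d)
      ∧ (∀ i : ℕ, 1 ≤ i → i ≤ C.m → ∀ b : ℤ,
          C.Eib i b (C.vB ν) = C.etaB ν i b • C.vB ν)
      -- (e)
      ∧ (∀ p : ℕ, 1 ≤ p → p + 1 ≤ C.n →
          (∑ᶠ k : ℤ, (∑ c : Fin C.m,
              (C.nord (C.psiS ((c : ℕ) + 1) p (-k - C.sig)) k
                  (C.psibarS ((c : ℕ) + 1) (p + 1) k)
                - C.nord (C.psiS ((c : ℕ) + 1) (C.n - p) (-k - C.sig)) k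
                    (C.psibarS ((c : ℕ) + 1) (C.n + 1 - p) k))) • C.vB ν) = 0)
      -- (f)
      ∧ (∀ p : ℕ, 1 ≤ p → p ≤ C.n / 2 →
          (∑ᶠ k : ℤ, (∑ c : Fin C.m,
              (C.nord (C.psiS ((c : ℕ) + 1) p (-k - C.sig)) k
                  (C.psibarS ((c : ℕ) + 1) p k)
                - C.nord (C.psiS ((c : ℕ) + 1) (C.n + 1 - p) (-k - C.sig)) k
                    (C.psibarS ((c : ℕ) + 1) (C.n + 1 - p) k))) • C.vB ν)
            = ((μ p : ℤ) : ℂ) • C.vB ν) := by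

  have hle : ∀ k, 1 ≤ k → k ≤ C.n → (0 < μ k ↔ k ≤ d) := fun k hk hkn =>
    pos_iff_le_card hdec hd hk hkn
  have hnonneg : ∀ k, 1 ≤ k → k ≤ C.n → 0 ≤ μ k := by
    intro k hk hkn
    induction hkn using Nat.decreasingInduction with
    | self => exact hpos
    | of_succ k hkn ih => exact (ih (by omega)).trans (hdec k hk hkn)
  have hzero : ∀ k, d < k → k ≤ C.n + 1 → μ k = 0 := by
    intro k hdk hkn
    rcases hkn.eq_or_lt with rfl | hlt
    · exact htop
    · have h1 := hnonneg k (by omega) (by omega)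
      have h2 := hle k (by omega) (by omega)
      omega
  have hn := C.hn
  intro ν hν
  have hcon : ∀ y z, contract y z (C.vpoly ν) = 0 := by
    rcases hν with rfl | rfl
    · exact C.contract_vpoly_partition hdhalf hzero
    · exact C.contract_vpoly_flipCol μ hdhalf
  have hdom : ∀ k, 1 ≤ k → k ≤ C.n → ν (k + 1) ≤ ν k := by
    intro k hk hkn
    have hmono : μ (k + 1) ≤ μ k := by
      rcases hkn.eq_or_lt with rfl | hlt
      · exact htop.trans_le hpos
      · exact hdec k hk hlt
    rcases hν with rfl | rfl
    · exact hmono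
    · have h1 := hle k hk hkn
      dsimp only
      split_ifs <;> omega
  have hweight : ∀ p, 1 ≤ p → p ≤ C.n / 2 → ν p - ν (C.n + 1 - p) = μ p := by
    intro p hp hpn
    have h1 := hzero (C.n + 1 - p) (by omega) (by omega)
    rcases hν with rfl | rfl
    · rw [h1, sub_zero]
    · have h2 := hzero p
      dsimp only
      split_ifs <;> omega
  refine ⟨?_, fun i j hi him hj hjm a b => C.Top_vB_eq_zero hcon hi him hj hjm b,
    fun i j hi him hj hjm a b => C.psi_psi_vB_eq_zero hcon hi him hj hjm b,
    fun i j hi him hj hjm a b => C.psibar_psibar_vB_eq_zero hcon hi him hj hjm b,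
    fun i hi him b => C.Eib_vB hdom hi him b,
    fun p hp hpn => C.finsum_raising_smul_vB_eq_zero ν hp hpn, fun p hp hpn => ?_⟩
  · rw [vB_eq]
    exact C.fock_ne_zero (C.vpoly_ne_zero ν)
  · rw [C.finsum_weight_smul_vB hdom hp (by omega), hweight p hp hpn]
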